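/- arXiv:2309.12123 — 12 statements merged into one kernel-verified Lean document; each statement's English description precedes it below -/
import Mathlib

section
/- Let I ⊆ ℝ be an open interval and let Γ : I → ℝ be smooth. If f : I × ℝ → ℝ is a smooth function satisfying the Kähler equations for Γ, then there exist smooth functions a : ℝ → ℝ, b : I → ℝ and p : I → ℝ with p'(x) = Γ(x) for all x ∈ I, such that f(x,y) = a(y)·e^{p(x)} + b(x) for all (x,y) ∈ I × ℝ. -/
/-- Partial derivative in the first variable. -/
noncomputable def pdx (f : ℝ → ℝ → ℝ) (x y : ℝ) : ℝ := deriv (fun t => f t y) x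

/-- Partial derivative in the second variable. -/
noncomputable def pdy (f : ℝ → ℝ → ℝ) (x y : ℝ) : ℝ := deriv (fun t => f x t) y

/-- The Kähler equations for a Christoffel symbol `Γ` on `I × ℝ`. -/
def KahlerEqs (I : Set ℝ) (Γ : ℝ → ℝ) (f : ℝ → ℝ → ℝ) : Prop :=
  ∀ x ∈ I, ∀ y : ℝ,
    pdx (pdx f) x y - pdy (pdy f) x y = 2 * Γ x * pdx f x y ∧
    pdx (pdy f) x y = Γ x * pdy f x y

/-- A continuous function on an open interval has a primitive there. -/
theorem exists_hasDerivAt_of_continuousOn {I : Set ℝ} (hI : IsOpen I) (hc : Convex ℝ I)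
    {g : ℝ → ℝ} (hg : ContinuousOn g I) : ∃ p : ℝ → ℝ, ∀ x ∈ I, HasDerivAt p (g x) x := by
  rcases I.eq_empty_or_nonempty with rfl | ⟨x₀, hx₀⟩
  · exact ⟨0, by simp⟩
  refine ⟨fun x => ∫ t in x₀..x, g t, fun x hx => ?_⟩
  have hsub : Set.uIcc x₀ x ⊆ I := hc.ordConnected.uIcc_subset hx₀ hx
  exact intervalIntegral.integral_hasDerivAt_right (hg.mono hsub).intervalIntegrable
    (hg.stronglyMeasurableAtFilter hI x hx) (hg.continuousAt (hI.mem_nhds hx))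

/-- A primitive of a smooth function on an open set is smooth. -/
theorem contDiffOn_of_hasDerivAt {I : Set ℝ} (hI : IsOpen I) {g p : ℝ → ℝ}
    (hg : ContDiffOn ℝ (⊤ : ℕ∞) g I) (hp : ∀ x ∈ I, HasDerivAt p (g x) x) :
    ContDiffOn ℝ (⊤ : ℕ∞) p I :=
  (contDiffOn_infty_iff_deriv_of_isOpen hI).2
    ⟨fun x hx => (hp x hx).differentiableAt.differentiableWithinAt,
      hg.congr fun x hx => (hp x hx).deriv⟩

/-- A solution of a first-order homogeneous linear equation with coefficient `g` is a constant
multiple of `exp p`, where `p` is a primitive of `g`. -/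
theorem mul_exp_neg_eq_of_hasDerivAt {I : Set ℝ} (hI : IsOpen I) (hc : Convex ℝ I)
    {g p u : ℝ → ℝ} (hp : ∀ x ∈ I, HasDerivAt p (g x) x)
    (hu : ∀ x ∈ I, HasDerivAt u (g x * u x) x) {x₀ x : ℝ} (hx₀ : x₀ ∈ I) (hx : x ∈ I) :
    u x * Real.exp (-p x) = u x₀ * Real.exp (-p x₀) := by
  have h : ∀ t ∈ I, HasDerivAt (fun t => u t * Real.exp (-p t)) 0 t := fun t ht => by
    refine ((hu t ht).mul (hp t ht).neg.exp).congr_deriv ?_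
    simp only [Pi.neg_apply]
    ring
  exact hI.is_const_of_deriv_eq_zero hc.isPreconnected
    (fun t ht => (h t ht).differentiableAt.differentiableWithinAt)
    (fun t ht => (h t ht).deriv) hx hx₀

/-- The second partial derivative as a directional derivative. -/
theorem hasDerivAt_snd_of_differentiableAt {f : ℝ → ℝ → ℝ} {x y : ℝ}
    (h : DifferentiableAt ℝ (fun p : ℝ × ℝ => f p.1 p.2) (x, y)) :
    HasDerivAt (fun t => f x t) (fderiv ℝ (fun p : ℝ × ℝ => f p.1 p.2) (x, y) (0, 1)) y :=
  HasFDerivAt.comp_hasDerivAt (f := fun t => (x, t)) y h.hasFDerivAt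
    ((hasDerivAt_const y x).prodMk (hasDerivAt_id y))

theorem stmt0 (I : Set ℝ) (hIopen : IsOpen I) (hIconv : Convex ℝ I)
    (Γ : ℝ → ℝ) (hΓ : ContDiffOn ℝ (⊤ : ℕ∞) Γ I)
    (f : ℝ → ℝ → ℝ)
    (hf : ContDiffOn ℝ (⊤ : ℕ∞) (fun p : ℝ × ℝ => f p.1 p.2) (I ×ˢ Set.univ))
    (hK : KahlerEqs I Γ f) :
    ∃ a b p : ℝ → ℝ, ContDiff ℝ (⊤ : ℕ∞) a ∧ ContDiffOn ℝ (⊤ : ℕ∞) b I ∧ ContDiffOn ℝ (⊤ : ℕ∞) p I ∧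
      (∀ x ∈ I, HasDerivAt p (Γ x) x) ∧
      (∀ x ∈ I, ∀ y : ℝ, f x y = a y * Real.exp (p x) + b x) := by
  rcases I.eq_empty_or_nonempty with rfl | ⟨x₀, hx₀⟩
  · exact ⟨0, 0, 0, contDiff_const, by simp, by simp, by simp, by simp⟩
  obtain ⟨p, hp⟩ := exists_hasDerivAt_of_continuousOn hIopen hIconv hΓ.continuousOn
  have hps := contDiffOn_of_hasDerivAt hIopen hΓ hp
  have hopen : IsOpen (I ×ˢ (Set.univ : Set ℝ)) := hIopen.prod isOpen_univ
  have hmem : ∀ x ∈ I, ∀ y : ℝ, (x, y) ∈ I ×ˢ (Set.univ : Set ℝ) := fun x hx y => ⟨hx, trivial⟩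
  have hfy : ∀ x ∈ I, ∀ y, HasDerivAt (fun t => f x t)
      (fderiv ℝ (fun p : ℝ × ℝ => f p.1 p.2) (x, y) (0, 1)) y := fun x hx y =>
    hasDerivAt_snd_of_differentiableAt
      ((hf.contDiffAt (hopen.mem_nhds (hmem x hx y))).differentiableAt (by simp))
  have hpdy : ∀ x ∈ I, ∀ y, HasDerivAt (fun t => f x t) (pdy f x y) y := fun x hx y =>
    (hfy x hx y).differentiableAt.hasDerivAt
  have hslice : ∀ y, ContDiffOn ℝ (⊤ : ℕ∞) (fun x => pdy f x y) I := fun y => by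
    have h := (hf.fderiv_of_isOpen (m := (⊤ : ℕ∞)) hopen (by simp)).clm_apply
      (contDiffOn_const (c := ((0 : ℝ), (1 : ℝ))))
    exact (h.comp (f := fun x => (x, y)) (contDiffOn_id.prodMk contDiffOn_const)
      fun x hx => hmem x hx y).congr fun x hx => (hfy x hx y).deriv
  have hode : ∀ y, ∀ x ∈ I, HasDerivAt (fun t => pdy f t y) (Γ x * pdy f x y) x := fun y x hx => by
    rw [← (hK x hx y).2]
    exact (((hslice y).contDiffAt (hIopen.mem_nhds hx)).differentiableAt (by simp)).hasDerivAt
  have hsep : ∀ x ∈ I, ∀ y,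
      f x y * Real.exp (-p x) - f x₀ y * Real.exp (-p x₀) =
        f x 0 * Real.exp (-p x) - f x₀ 0 * Real.exp (-p x₀) := fun x hx y => by
    have h : ∀ t, HasDerivAt
        (fun t => f x t * Real.exp (-p x) - f x₀ t * Real.exp (-p x₀)) 0 t := fun t => by
      refine (((hpdy x hx t).mul_const (Real.exp (-p x))).sub
        ((hpdy x₀ hx₀ t).mul_const (Real.exp (-p x₀)))).congr_deriv ?_
      rw [mul_exp_neg_eq_of_hasDerivAt hIopen hIconv hp (hode t) hx₀ hx, sub_self]
    exact is_const_of_deriv_eq_zero (fun t => (h t).differentiableAt) (fun t => (h t).deriv) y 0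
  refine ⟨fun y => (f x₀ y - f x₀ 0) * Real.exp (-p x₀), fun x => f x 0, p, ?_, ?_, hps, hp, ?_⟩
  · have h : ContDiff ℝ (⊤ : ℕ∞) (fun y => f x₀ y) := contDiffOn_univ.1 <|
      hf.comp (f := fun y => (x₀, y)) (contDiffOn_const.prodMk contDiffOn_id)
        fun y _ => hmem x₀ hx₀ y
    exact (h.sub contDiff_const).mul contDiff_const
  · exact hf.comp (f := fun x => (x, (0 : ℝ))) (contDiffOn_id.prodMk contDiffOn_const)
      fun x hx => hmem x hx 0
  · intro x hx y
    have he : Real.exp (-p x) * Real.exp (p x) = 1 := by rw [← Real.exp_add]; simp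
    linear_combination Real.exp (p x) * hsep x hx y - (f x y - f x 0) * he
end

section
/- Let I ⊆ ℝ be an open interval and let Γ : I → ℝ be smooth. If f : I × ℝ → ℝ is a smooth function satisfying the Kähler equations for Γ, then for all x₀, x₁ ∈ I and all y ∈ ℝ one has (∂²f/∂y²)(x₀,y) · (d/dx)[Γ'(x) − Γ(x)²]|_{x=x₁} = 0. In particular, if ∂²f/∂y² is nonzero at some point of I × ℝ, then the function Γ' − Γ² is constant on I. -/
open scoped ContDiff

/-- `f`, uncurried, is smooth on the strip `I × ℝ`. -/
def SmoothOnStrip (I : Set ℝ) (f : ℝ → ℝ → ℝ) : Prop :=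
  ContDiffOn ℝ ∞ (fun p : ℝ × ℝ => f p.1 p.2) (I ×ˢ Set.univ)

namespace SmoothOnStrip

variable {I : Set ℝ} {f : ℝ → ℝ → ℝ} {x : ℝ}

theorem contDiffAt (hf : SmoothOnStrip I f) (hI : IsOpen I) (hx : x ∈ I) (y : ℝ) :
    ContDiffAt ℝ ∞ (fun p : ℝ × ℝ => f p.1 p.2) (x, y) :=
  ContDiffOn.contDiffAt hf ((hI.prod isOpen_univ).mem_nhds ⟨hx, trivial⟩)

theorem hasFDerivAt (hf : SmoothOnStrip I f) (hI : IsOpen I) (hx : x ∈ I) (y : ℝ) :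
    HasFDerivAt (fun p : ℝ × ℝ => f p.1 p.2)
      (fderiv ℝ (fun p : ℝ × ℝ => f p.1 p.2) (x, y)) (x, y) :=
  ((hf.contDiffAt hI hx y).differentiableAt (by simp)).hasFDerivAt

theorem hasDerivAt_fst_fderiv (hf : SmoothOnStrip I f) (hI : IsOpen I) (hx : x ∈ I) (y : ℝ) :
    HasDerivAt (fun t => f t y) (fderiv ℝ (fun p : ℝ × ℝ => f p.1 p.2) (x, y) (1, 0)) x :=
  (hf.hasFDerivAt hI hx y).comp_hasDerivAt (f := fun t => (t, y)) x
    ((hasDerivAt_id x).prodMk (hasDerivAt_const x y))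

theorem hasDerivAt_snd_fderiv (hf : SmoothOnStrip I f) (hI : IsOpen I) (hx : x ∈ I) (y : ℝ) :
    HasDerivAt (fun t => f x t) (fderiv ℝ (fun p : ℝ × ℝ => f p.1 p.2) (x, y) (0, 1)) y :=
  (hf.hasFDerivAt hI hx y).comp_hasDerivAt (f := fun t => (x, t)) y
    ((hasDerivAt_const y x).prodMk (hasDerivAt_id y))

theorem hasDerivAt_pdx (hf : SmoothOnStrip I f) (hI : IsOpen I) (hx : x ∈ I) (y : ℝ) :
    HasDerivAt (fun t => f t y) (pdx f x y) x :=
  (hf.hasDerivAt_fst_fderiv hI hx y).differentiableAt.hasDerivAt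

theorem hasDerivAt_pdy (hf : SmoothOnStrip I f) (hI : IsOpen I) (hx : x ∈ I) (y : ℝ) :
    HasDerivAt (fun t => f x t) (pdy f x y) y :=
  (hf.hasDerivAt_snd_fderiv hI hx y).differentiableAt.hasDerivAt

theorem contDiffOn_fderiv_apply (hf : SmoothOnStrip I f) (hI : IsOpen I) (v : ℝ × ℝ) :
    ContDiffOn ℝ ∞ (fun p => fderiv ℝ (fun p : ℝ × ℝ => f p.1 p.2) p v) (I ×ˢ Set.univ) :=
  (ContDiffOn.fderiv_of_isOpen hf (hI.prod isOpen_univ) (by simp)).clm_apply contDiffOn_const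

theorem smooth_pdx (hf : SmoothOnStrip I f) (hI : IsOpen I) : SmoothOnStrip I (pdx f) :=
  (hf.contDiffOn_fderiv_apply hI (1, 0)).congr fun p hp =>
    (hf.hasDerivAt_fst_fderiv hI hp.1 p.2).deriv

theorem smooth_pdy (hf : SmoothOnStrip I f) (hI : IsOpen I) : SmoothOnStrip I (pdy f) :=
  (hf.contDiffOn_fderiv_apply hI (0, 1)).congr fun p hp =>
    (hf.hasDerivAt_snd_fderiv hI hp.1 p.2).deriv

/-- Partial derivatives commute. -/
theorem pdx_pdy_comm (hf : SmoothOnStrip I f) (hI : IsOpen I) (hx : x ∈ I) (y : ℝ) :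
    pdx (pdy f) x y = pdy (pdx f) x y := by
  set F : ℝ × ℝ → ℝ := fun p => f p.1 p.2
  have hsymm : IsSymmSndFDerivAt ℝ F (x, y) :=
    (hf.contDiffAt hI hx y).isSymmSndFDerivAt
      (by rw [minSmoothness_of_isRCLikeNormedField]; exact WithTop.coe_le_coe.2 le_top)
  have hF : HasFDerivAt (fderiv ℝ F) (fderiv ℝ (fderiv ℝ F) (x, y)) (x, y) :=
    (((hf.contDiffAt hI hx y).fderiv_right (m := 1) (WithTop.coe_le_coe.2 le_top)).differentiableAt
      (by simp)).hasFDerivAt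
  have h₁ : HasDerivAt (fun t => fderiv ℝ F (t, y) (0, 1))
      (fderiv ℝ (fderiv ℝ F) (x, y) (1, 0) (0, 1)) x := by
    simpa using (hF.comp_hasDerivAt (f := fun t => (t, y)) x
      ((hasDerivAt_id x).prodMk (hasDerivAt_const x y))).clm_apply
        (hasDerivAt_const x ((0, 1) : ℝ × ℝ))
  have h₂ : HasDerivAt (fun t => fderiv ℝ F (x, t) (1, 0))
      (fderiv ℝ (fderiv ℝ F) (x, y) (0, 1) (1, 0)) y := by
    simpa using (hF.comp_hasDerivAt (f := fun t => (x, t)) y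
      ((hasDerivAt_const y x).prodMk (hasDerivAt_id y))).clm_apply
        (hasDerivAt_const y ((1, 0) : ℝ × ℝ))
  have e₁ : (fun t => pdy f t y) =ᶠ[nhds x] fun t => fderiv ℝ F (t, y) (0, 1) := by
    filter_upwards [hI.mem_nhds hx] with t ht
    exact (hf.hasDerivAt_snd_fderiv hI ht y).deriv
  have e₂ : (fun t => pdx f x t) = fun t => fderiv ℝ F (x, t) (1, 0) :=
    funext fun t => (hf.hasDerivAt_fst_fderiv hI hx t).deriv
  calc pdx (pdy f) x y
      = fderiv ℝ (fderiv ℝ F) (x, y) (1, 0) (0, 1) := (h₁.congr_of_eventuallyEq e₁).deriv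
    _ = fderiv ℝ (fderiv ℝ F) (x, y) (0, 1) (1, 0) := hsymm _ _
    _ = pdy (pdx f) x y := by
      rw [pdy, e₂, h₂.deriv]

end SmoothOnStrip

/-- A solution of `u' = Γ u` on an interval is the product of its
initial value with a nonvanishing integrating factor that depends only on `Γ`. -/
theorem exists_integrating_factor {I : Set ℝ} (hI : IsOpen I) (hconv : Convex ℝ I) {Γ : ℝ → ℝ}
    (hΓ : ContinuousOn Γ I) {x₀ : ℝ} (hx₀ : x₀ ∈ I) :
    ∃ E : ℝ → ℝ, (∀ x, E x ≠ 0) ∧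
      ∀ u : ℝ → ℝ, (∀ x ∈ I, HasDerivAt u (Γ x * u x) x) → ∀ x ∈ I, u x = E x * u x₀ := by
  set G : ℝ → ℝ := fun x => ∫ t in x₀..x, Γ t
  have hG : ∀ x ∈ I, HasDerivAt G (Γ x) x := fun x hx =>
    intervalIntegral.integral_hasDerivAt_right
      (hΓ.mono (hconv.ordConnected.uIcc_subset hx₀ hx)).intervalIntegrable
      (hΓ.stronglyMeasurableAtFilter hI x hx) (hΓ.continuousAt (hI.mem_nhds hx))
  refine ⟨fun x => Real.exp (G x), fun x => (Real.exp_pos _).ne', fun u hu x hx => ?_⟩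
  have hd : ∀ z ∈ I, HasDerivAt (fun z => u z * Real.exp (-G z)) 0 z := fun z hz => by
    refine ((hu z hz).mul (hG z hz).neg.exp).congr_deriv ?_
    ring
  have hconst : u x * Real.exp (-G x) = u x₀ * Real.exp (-G x₀) :=
    hI.is_const_of_deriv_eq_zero hconv.isPreconnected
      (fun z hz => (hd z hz).differentiableAt.differentiableWithinAt)
      (fun z hz => (hd z hz).deriv) hx hx₀
  have hG₀ : G x₀ = 0 := intervalIntegral.integral_same
  rw [hG₀, neg_zero, Real.exp_zero, mul_one] at hconst
  rw [← hconst, mul_comm (u x), ← mul_assoc, ← Real.exp_add, add_neg_cancel, Real.exp_zero,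
    one_mul]

/-- A Kähler function satisfies `∂³f/∂y³ = (Γ' - Γ²) ∂f/∂y`. -/
theorem KahlerEqs.pdy_pdy_pdy {I : Set ℝ} (hI : IsOpen I) {Γ : ℝ → ℝ}
    (hΓ : DifferentiableOn ℝ Γ I) {f : ℝ → ℝ → ℝ} (hf : SmoothOnStrip I f)
    (hK : KahlerEqs I Γ f) {x : ℝ} (hx : x ∈ I) (y : ℝ) :
    pdy (pdy (pdy f)) x y = (deriv Γ x - Γ x ^ 2) * pdy f x y := by
  have hfx := hf.smooth_pdx hI
  have hfy := hf.smooth_pdy hI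
  have hxy : ∀ z ∈ I, ∀ y, pdy (pdx f) z y = Γ z * pdy f z y := fun z hz y => by
    rw [← hf.pdx_pdy_comm hI hz, (hK z hz y).2]
  have hΓx : HasDerivAt Γ (deriv Γ x) x := (hΓ.differentiableAt (hI.mem_nhds hx)).hasDerivAt
  have hxxy : pdy (pdx (pdx f)) x y = deriv Γ x * pdy f x y + Γ x * (Γ x * pdy f x y) := by
    have h := hΓx.mul (hfy.hasDerivAt_pdx hI hx y)
    rw [(hK x hx y).2] at h
    rw [← hfx.pdx_pdy_comm hI hx]
    refine (h.congr_of_eventuallyEq ?_).deriv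
    filter_upwards [hI.mem_nhds hx] with z hz using hxy z hz y
  have h₁ := ((hfx.smooth_pdx hI).hasDerivAt_pdy hI hx y).sub ((hfy.smooth_pdy hI).hasDerivAt_pdy hI hx y)
  have h₂ := (hfx.hasDerivAt_pdy hI hx y).const_mul (2 * Γ x)
  have h := h₁.unique (h₂.congr_of_eventuallyEq (.of_forall fun t => (hK x hx t).1))
  rw [hxxy, hxy x hx] at h
  linear_combination -h

/-- If a Kähler function has `∂²f/∂y² ≠ 0` somewhere, then `Γ' - Γ²` is constant. -/
theorem KahlerEqs.deriv_sub_sq_eq {I : Set ℝ} (hI : IsOpen I) (hconv : Convex ℝ I) {Γ : ℝ → ℝ}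
    (hΓ : DifferentiableOn ℝ Γ I) {f : ℝ → ℝ → ℝ} (hf : SmoothOnStrip I f)
    (hK : KahlerEqs I Γ f) {x₀ : ℝ} (hx₀ : x₀ ∈ I) {y : ℝ} (hne : pdy (pdy f) x₀ y ≠ 0)
    {x : ℝ} (hx : x ∈ I) :
    deriv Γ x - Γ x ^ 2 = deriv Γ x₀ - Γ x₀ ^ 2 := by
  obtain ⟨E, hE, hsol⟩ := exists_integrating_factor hI hconv hΓ.continuousOn hx₀
  have hfy : ∀ t, pdy f x t = E x * pdy f x₀ t := fun t =>
    hsol (fun z => pdy f z t)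
      (fun z hz => (hK z hz t).2 ▸ (hf.smooth_pdy hI).hasDerivAt_pdx hI hz t) x hx
  obtain ⟨t, ht⟩ : ∃ t, pdy f x₀ t ≠ 0 := by
    by_contra! h
    exact hne ((hasDerivAt_const y (0 : ℝ)).congr_of_eventuallyEq (.of_forall h)).deriv
  have hfyy : ∀ t, pdy (pdy f) x t = E x * pdy (pdy f) x₀ t := fun t =>
    ((((hf.smooth_pdy hI).hasDerivAt_pdy hI hx₀ t).const_mul (E x)).congr_of_eventuallyEq
      (.of_forall hfy)).deriv
  have hfyyy : pdy (pdy (pdy f)) x t = E x * pdy (pdy (pdy f)) x₀ t :=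
    (((((hf.smooth_pdy hI).smooth_pdy hI).hasDerivAt_pdy hI hx₀ t).const_mul (E x)).congr_of_eventuallyEq
      (.of_forall hfyy)).deriv
  rw [hK.pdy_pdy_pdy hI hΓ hf hx, hK.pdy_pdy_pdy hI hΓ hf hx₀, hfy] at hfyyy
  refine mul_right_cancel₀ (mul_ne_zero (hE x) ht) ?_
  linear_combination hfyyy

theorem stmt1 (I : Set ℝ) (hIopen : IsOpen I) (hIconv : Convex ℝ I)
    (Γ : ℝ → ℝ) (hΓ : ContDiffOn ℝ (⊤ : ℕ∞) Γ I)
    (f : ℝ → ℝ → ℝ)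
    (hf : ContDiffOn ℝ (⊤ : ℕ∞) (fun p : ℝ × ℝ => f p.1 p.2) (I ×ˢ Set.univ))
    (hK : KahlerEqs I Γ f) :
    (∀ x₀ ∈ I, ∀ x₁ ∈ I, ∀ y : ℝ,
      pdy (pdy f) x₀ y * deriv (fun x => deriv Γ x - Γ x ^ 2) x₁ = 0) ∧
    ((∃ x ∈ I, ∃ y : ℝ, pdy (pdy f) x y ≠ 0) →
      ∀ x₀ ∈ I, ∀ x₁ ∈ I, deriv Γ x₀ - Γ x₀ ^ 2 = deriv Γ x₁ - Γ x₁ ^ 2) := by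
  have hΓ' : DifferentiableOn ℝ Γ I := hΓ.differentiableOn (by simp)
  have hconst : ∀ x₀ ∈ I, ∀ y, pdy (pdy f) x₀ y ≠ 0 → ∀ x ∈ I,
      deriv Γ x - Γ x ^ 2 = deriv Γ x₀ - Γ x₀ ^ 2 := fun x₀ hx₀ y hne x hx =>
    hK.deriv_sub_sq_eq hIopen hIconv hΓ' hf hx₀ hne hx
  refine ⟨fun x₀ hx₀ x₁ hx₁ y => ?_, ?_⟩
  · rw [mul_eq_zero, or_iff_not_imp_left]
    intro hne
    refine ((hasDerivAt_const x₁ (deriv Γ x₀ - Γ x₀ ^ 2)).congr_of_eventuallyEq ?_).deriv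
    filter_upwards [hIopen.mem_nhds hx₁] with x hx using hconst x₀ hx₀ y hne x hx
  · rintro ⟨x, hx, y, hne⟩ x₀ hx₀ x₁ hx₁
    rw [hconst x hx y hne x₀ hx₀, hconst x hx y hne x₁ hx₁]
end

section
/- Let λ > 0 be a real number, let I ⊆ ℝ be a connected open interval, and let g : I → ℝ be a smooth positive function such that (d²/dx²) ln g(x) = 2λ·g(x) for all x ∈ I. Then there exist real numbers a > 0 and b such that one of the following holds for all x ∈ I: g(x) = a/(λ·cos²(√a·x + b)), or g(x) = a/(λ·sinh²(√a·x + b)), or g(x) = 1/(λ·(x + b)²). -/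
/-- A function with vanishing derivative on an open convex set of reals is constant there. -/
theorem exists_eq_const_of_hasDerivAt_zero {I : Set ℝ} (hIopen : IsOpen I) (hIconv : Convex ℝ I)
    {f : ℝ → ℝ} (hf : ∀ x ∈ I, HasDerivAt f 0 x) : ∃ c, ∀ x ∈ I, f x = c :=
  hIopen.exists_is_const_of_deriv_eq_zero hIconv.isPreconnected
    (fun x hx => (hf x hx).differentiableAt.differentiableWithinAt)
    (fun x hx => (hf x hx).deriv)

theorem exists_cos_eq_sin_eq {p q : ℝ} (h : p ^ 2 + q ^ 2 = 1) :
    ∃ b : ℝ, Real.cos b = p ∧ Real.sin b = q := by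
  have hn : ‖(⟨p, q⟩ : ℂ)‖ = 1 := by
    rw [← sq_eq_sq₀ (norm_nonneg _) zero_le_one, Complex.sq_norm, Complex.normSq_mk]
    linarith
  have hz : (⟨p, q⟩ : ℂ) ≠ 0 := by
    intro h0
    rw [h0, norm_zero] at hn
    exact zero_ne_one hn
  exact ⟨Complex.arg ⟨p, q⟩, by rw [Complex.cos_arg hz, hn, div_one],
    by rw [Complex.sin_arg, hn, div_one]⟩

section SecondOrder

variable {I : Set ℝ} {w v : ℝ → ℝ} {k : ℝ}

theorem exists_sq_eq_cos_sq (hIopen : IsOpen I) (hIconv : Convex ℝ I)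
    (hw : ∀ x ∈ I, HasDerivAt w (v x) x) (hv : ∀ x ∈ I, HasDerivAt v (-k ^ 2 * w x) x)
    (hE : ∀ x ∈ I, v x ^ 2 = 1 - k ^ 2 * w x ^ 2) :
    ∃ b, ∀ x ∈ I, (k * w x) ^ 2 = Real.cos (k * x + b) ^ 2 := by
  rcases I.eq_empty_or_nonempty with rfl | ⟨x₀, hx₀⟩
  · exact ⟨0, by simp⟩
  have hlin : ∀ x, HasDerivAt (fun t => k * t) k x := fun x => by
    simpa using (hasDerivAt_id x).const_mul k
  obtain ⟨p, hp⟩ := exists_eq_const_of_hasDerivAt_zero hIopen hIconv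
    (f := fun x => v x * Real.cos (k * x) + k * w x * Real.sin (k * x)) (fun x hx => by
      refine HasDerivAt.congr_deriv
        (((hv x hx).mul (hlin x).cos).add (((hw x hx).const_mul k).mul (hlin x).sin)) ?_
      ring)
  obtain ⟨q, hq⟩ := exists_eq_const_of_hasDerivAt_zero hIopen hIconv
    (f := fun x => k * w x * Real.cos (k * x) - v x * Real.sin (k * x)) (fun x hx => by
      refine HasDerivAt.congr_deriv
        ((((hw x hx).const_mul k).mul (hlin x).cos).sub ((hv x hx).mul (hlin x).sin)) ?_
      ring)
  have hpq : q ^ 2 + (-p) ^ 2 = 1 := by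
    rw [← hp x₀ hx₀, ← hq x₀ hx₀]
    linear_combination hE x₀ hx₀ +
      (v x₀ ^ 2 + k ^ 2 * w x₀ ^ 2) * Real.sin_sq_add_cos_sq (k * x₀)
  obtain ⟨b, hcos, hsin⟩ := exists_cos_eq_sin_eq hpq
  refine ⟨b, fun x hx => ?_⟩
  rw [Real.cos_add, hcos, hsin, ← hp x hx, ← hq x hx]
  congr 1
  linear_combination -(k * w x) * Real.sin_sq_add_cos_sq (k * x)

theorem exists_sq_eq_sinh_sq (hIopen : IsOpen I) (hIconv : Convex ℝ I)
    (hw : ∀ x ∈ I, HasDerivAt w (v x) x) (hv : ∀ x ∈ I, HasDerivAt v (k ^ 2 * w x) x)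
    (hE : ∀ x ∈ I, v x ^ 2 = 1 + k ^ 2 * w x ^ 2) :
    ∃ b, ∀ x ∈ I, (k * w x) ^ 2 = Real.sinh (k * x + b) ^ 2 := by
  rcases I.eq_empty_or_nonempty with rfl | ⟨x₀, hx₀⟩
  · exact ⟨0, by simp⟩
  have hlin : ∀ x, HasDerivAt (fun t => k * t) k x := fun x => by
    simpa using (hasDerivAt_id x).const_mul k
  obtain ⟨p, hp⟩ := exists_eq_const_of_hasDerivAt_zero hIopen hIconv
    (f := fun x => v x * Real.cosh (k * x) - k * w x * Real.sinh (k * x)) (fun x hx => by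
      refine HasDerivAt.congr_deriv
        (((hv x hx).mul (hlin x).cosh).sub (((hw x hx).const_mul k).mul (hlin x).sinh)) ?_
      ring)
  obtain ⟨q, hq⟩ := exists_eq_const_of_hasDerivAt_zero hIopen hIconv
    (f := fun x => k * w x * Real.cosh (k * x) - v x * Real.sinh (k * x)) (fun x hx => by
      refine HasDerivAt.congr_deriv
        ((((hw x hx).const_mul k).mul (hlin x).cosh).sub ((hv x hx).mul (hlin x).sinh)) ?_
      ring)
  have hpq : p ^ 2 = 1 + q ^ 2 := by
    rw [← hp x₀ hx₀, ← hq x₀ hx₀]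
    linear_combination hE x₀ hx₀ +
      (v x₀ ^ 2 - k ^ 2 * w x₀ ^ 2) * Real.cosh_sq_sub_sinh_sq (k * x₀)
  have key : ∀ x ∈ I, k * w x = p * Real.sinh (k * x) + q * Real.cosh (k * x) := fun x hx => by
    rw [← hp x hx, ← hq x hx]
    linear_combination -(k * w x) * Real.cosh_sq_sub_sinh_sq (k * x)
  rcases le_total 0 p with h | h
  · refine ⟨Real.arsinh q, fun x hx => ?_⟩
    rw [key x hx, Real.sinh_add, Real.sinh_arsinh, Real.cosh_arsinh, ← hpq, Real.sqrt_sq h]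
    ring
  · refine ⟨Real.arsinh (-q), fun x hx => ?_⟩
    rw [key x hx, Real.sinh_add, Real.sinh_arsinh, Real.cosh_arsinh, neg_sq, ← hpq,
      Real.sqrt_sq_eq_abs,
      abs_of_nonpos h]
    ring

theorem exists_sq_eq_add_sq (hIopen : IsOpen I) (hIconv : Convex ℝ I)
    (hw : ∀ x ∈ I, HasDerivAt w (v x) x) (hv : ∀ x ∈ I, HasDerivAt v 0 x)
    (hE : ∀ x ∈ I, v x ^ 2 = 1) :
    ∃ b, ∀ x ∈ I, w x ^ 2 = (x + b) ^ 2 := by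
  rcases I.eq_empty_or_nonempty with rfl | ⟨x₀, hx₀⟩
  · exact ⟨0, by simp⟩
  obtain ⟨s, hs⟩ := exists_eq_const_of_hasDerivAt_zero hIopen hIconv hv
  obtain ⟨c, hc⟩ := exists_eq_const_of_hasDerivAt_zero hIopen hIconv
    (f := fun x => w x - s * x) (fun x hx => by
      refine HasDerivAt.congr_deriv ((hw x hx).sub ((hasDerivAt_id x).const_mul s)) ?_
      rw [hs x hx]
      ring)
  have hs2 : s ^ 2 = 1 := hs x₀ hx₀ ▸ hE x₀ hx₀
  refine ⟨s * c, fun x hx => ?_⟩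
  have hwx : w x = s * x + c := by linear_combination hc x hx
  rw [hwx]
  linear_combination (x ^ 2 - c ^ 2) * hs2

end SecondOrder

theorem stmt4 (lam : ℝ) (hlam : 0 < lam) (I : Set ℝ) (hIopen : IsOpen I) (hIconv : Convex ℝ I)
    (g : ℝ → ℝ) (hsm : ContDiffOn ℝ (⊤ : ℕ∞) g I) (hpos : ∀ x ∈ I, 0 < g x)
    (hcurv : ∀ x ∈ I, deriv (deriv (fun t => Real.log (g t))) x = 2 * lam * g x) :
    ∃ a b : ℝ, 0 < a ∧
      ((∀ x ∈ I, g x = a / (lam * Real.cos (Real.sqrt a * x + b) ^ 2)) ∨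
       (∀ x ∈ I, g x = a / (lam * Real.sinh (Real.sqrt a * x + b) ^ 2)) ∨
       (∀ x ∈ I, g x = 1 / (lam * (x + b) ^ 2))) := by
  set f : ℝ → ℝ := fun t => Real.log (g t) with hf
  have hfsm : ContDiffOn ℝ (⊤ : ℕ∞) f I := hsm.log fun x hx => (hpos x hx).ne'
  have hf1 : ∀ x ∈ I, HasDerivAt f (deriv f x) x := fun x hx =>
    ((hfsm.differentiableOn (by simp)).differentiableAt (hIopen.mem_nhds hx)).hasDerivAt
  have hf2 : ∀ x ∈ I, HasDerivAt (deriv f) (2 * lam * g x) x := fun x hx => by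
    have h1 : ContDiffOn ℝ 1 (deriv f) I :=
      hfsm.deriv_of_isOpen hIopen (WithTop.coe_le_coe.2 le_top)
    rw [← hcurv x hx]
    exact ((h1.differentiableOn one_ne_zero).differentiableAt (hIopen.mem_nhds hx)).hasDerivAt
  have hg : ∀ x ∈ I, HasDerivAt g (g x * deriv f x) x := fun x hx => by
    have h := (hf1 x hx).exp
    rw [hf, Real.exp_log (hpos x hx)] at h
    refine h.congr_of_eventuallyEq ?_
    filter_upwards [hIopen.mem_nhds hx] with y hy
    exact (Real.exp_log (hpos y hy)).symm
  obtain ⟨E, hE⟩ := exists_eq_const_of_hasDerivAt_zero hIopen hIconv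
    (f := fun x => deriv f x ^ 2 / 4 - lam * g x) (fun x hx => by
      refine HasDerivAt.congr_deriv
        ((((hf2 x hx).pow 2).div_const 4).sub ((hg x hx).const_mul lam)) ?_
      push_cast
      ring)
  -- The substitution `w = (lam * g)^(-1/2)` linearizes the equation to `w'' = E * w`.
  set w : ℝ → ℝ := fun x => Real.exp (-(f x) / 2) / √lam with hwdef
  set v : ℝ → ℝ := fun x => -(deriv f x) / 2 * w x with hvdef
  have hwpos : ∀ x, 0 < w x := fun x => by positivity
  have hwsq : ∀ x ∈ I, lam * g x * w x ^ 2 = 1 := fun x hx => by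
    have h : Real.exp (-(f x) / 2) ^ 2 = (g x)⁻¹ := by
      rw [← Real.exp_nat_mul, ← Real.exp_log (hpos x hx), ← Real.exp_neg]
      congr 1
      push_cast
      simp only [hf]
      ring
    have := (hpos x hx).ne'
    rw [hwdef]
    simp only [div_pow]
    rw [h, Real.sq_sqrt hlam.le]
    field_simp
  have hw : ∀ x ∈ I, HasDerivAt w (v x) x := fun x hx => by
    refine HasDerivAt.congr_deriv (((hf1 x hx).neg.div_const 2).exp.div_const √lam) ?_
    simp only [hvdef, hwdef, Pi.neg_apply]
    ring
  have hv : ∀ x ∈ I, HasDerivAt v (E * w x) x := fun x hx => by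
    refine HasDerivAt.congr_deriv (((hf2 x hx).neg.div_const 2).mul (hw x hx)) ?_
    rw [← hE x hx]
    simp only [hvdef, Pi.neg_apply]
    ring
  have hv2 : ∀ x ∈ I, v x ^ 2 = 1 + E * w x ^ 2 := fun x hx => by
    rw [← hwsq x hx, ← hE x hx]
    simp only [hvdef]
    ring
  have hgw : ∀ x ∈ I, ∀ {c y : ℝ}, c ≠ 0 → c * w x ^ 2 = y → g x = c / (lam * y) := by
    intro x hx c y hc hy
    have := (hwpos x).ne'
    rw [← hy, eq_div_iff (by positivity)]
    linear_combination c * hwsq x hx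
  rcases lt_trichotomy E 0 with h | h | h
  · have hs : √(-E) ^ 2 = -E := Real.sq_sqrt (by linarith)
    obtain ⟨b, hb⟩ := exists_sq_eq_cos_sq (k := √(-E)) hIopen hIconv hw
      (by simpa [hs] using hv) (by simpa [hs] using hv2)
    refine ⟨-E, b, by linarith, Or.inl fun x hx => hgw x hx (by linarith) ?_⟩
    rw [← hb x hx, mul_pow, hs]
  · subst h
    obtain ⟨b, hb⟩ := exists_sq_eq_add_sq hIopen hIconv hw
      (by simpa using hv) (by simpa using hv2)
    exact ⟨1, b, one_pos, Or.inr (Or.inr fun x hx =>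
      hgw x hx one_ne_zero (by rw [one_mul, hb x hx]))⟩
  · have hs : √E ^ 2 = E := Real.sq_sqrt h.le
    obtain ⟨b, hb⟩ := exists_sq_eq_sinh_sq (k := √E) hIopen hIconv hw
      (by simpa [hs] using hv) (by simpa [hs] using hv2)
    refine ⟨E, b, h, Or.inr (Or.inl fun x hx => hgw x hx h.ne' ?_)⟩
    rw [← hb x hx, mul_pow, hs]
end

section
/- Let λ < 0 be a real number, let I ⊆ ℝ be a connected open interval, and let g : I → ℝ be a smooth positive function such that (d²/dx²) ln g(x) = 2λ·g(x) for all x ∈ I. Then there exist real numbers a > 0 and b such that g(x) = −a/(λ·cosh²(√a·x + b)) for all x ∈ I. -/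
/-- A function with zero derivative on an open preconnected set is constant there. -/
theorem IsOpen.eq_of_hasDerivAt_zero {I : Set ℝ} (hI : IsOpen I) (hI' : IsPreconnected I)
    {f : ℝ → ℝ} (hf : ∀ x ∈ I, HasDerivAt f 0 x) {x y : ℝ} (hx : x ∈ I) (hy : y ∈ I) :
    f x = f y :=
  hI.is_const_of_deriv_eq_zero hI'
    (fun z hz => (hf z hz).differentiableAt.differentiableWithinAt)
    (fun z hz => (hf z hz).deriv) hx hy

/-- Solutions of the Riccati equation `p' = s ^ 2 - p ^ 2` with values in `(-s, s)` satisfy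
`s ^ 2 - p ^ 2 = s ^ 2 / cosh ^ 2 (s * x + b)`. -/
theorem exists_sq_sub_sq_eq_of_riccati {I : Set ℝ} (hI : IsOpen I) (hI' : IsPreconnected I)
    {s : ℝ} {p : ℝ → ℝ} (hlow : ∀ x ∈ I, 0 < s + p x) (hupp : ∀ x ∈ I, 0 < s - p x)
    (hp : ∀ x ∈ I, HasDerivAt p (s ^ 2 - p x ^ 2) x) :
    ∃ b : ℝ, ∀ x ∈ I, s ^ 2 - p x ^ 2 = s ^ 2 / Real.cosh (s * x + b) ^ 2 := by
  rcases I.eq_empty_or_nonempty with rfl | ⟨x₀, hx₀⟩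
  · exact ⟨0, by simp⟩
  let L : ℝ → ℝ := fun x => Real.log (s + p x) - Real.log (s - p x) - 2 * s * x
  have hL : ∀ x ∈ I, HasDerivAt L 0 x := by
    intro x hx
    have h₁ := hlow x hx
    have h₂ := hupp x hx
    refine (((((hp x hx).const_add s).log h₁.ne').sub
      (((hp x hx).const_sub s).log h₂.ne')).sub
        ((hasDerivAt_id x).const_mul (2 * s))).congr_deriv ?_
    field_simp
    ring
  refine ⟨L x₀ / 2, fun x hx => ?_⟩
  have h₁ := hlow x hx
  have h₂ := hupp x hx
  set θ := s * x + L x₀ / 2 with hθ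
  have hlog : Real.log (s + p x) = Real.log (s - p x) + (θ + θ) := by
    have hc : L x = L x₀ := hI.eq_of_hasDerivAt_zero hI' hL hx hx₀
    rw [hθ, ← hc]
    simp only [L]
    ring
  have hE : s + p x = (s - p x) * (Real.exp θ * Real.exp θ) := by
    rw [← Real.exp_log h₁, hlog, Real.exp_add, Real.exp_add, Real.exp_log h₂]
  have hEpos := Real.exp_pos θ
  rw [eq_div_iff (by positivity), Real.cosh_eq, Real.exp_neg]
  generalize Real.exp θ = E at hE hEpos
  have hs : s = (s - p x) * (1 + E * E) / 2 := by linarith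
  have hprod : s ^ 2 - p x ^ 2 = (s - p x) ^ 2 * E ^ 2 := by
    linear_combination (s - p x) * hE
  rw [hprod]
  conv_rhs => rw [hs]
  field_simp
  ring

theorem stmt5 (lam : ℝ) (hlam : lam < 0) (I : Set ℝ) (hIopen : IsOpen I) (hIconv : Convex ℝ I)
    (g : ℝ → ℝ) (hsm : ContDiffOn ℝ (⊤ : ℕ∞) g I) (hpos : ∀ x ∈ I, 0 < g x)
    (hcurv : ∀ x ∈ I, deriv (deriv (fun t => Real.log (g t))) x = 2 * lam * g x) :
    ∃ a b : ℝ, 0 < a ∧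
      ∀ x ∈ I, g x = -a / (lam * Real.cosh (Real.sqrt a * x + b) ^ 2) := by
  rcases I.eq_empty_or_nonempty with rfl | ⟨x₀, hx₀⟩
  · exact ⟨1, 0, one_pos, by simp⟩
  have hconn := hIconv.isPreconnected
  set u : ℝ → ℝ := fun t => Real.log (g t) with hu
  have hu_smooth : ContDiffOn ℝ (⊤ : ℕ∞) u I := hsm.log fun x hx => (hpos x hx).ne'
  have hg : ∀ x ∈ I, HasDerivAt g (g x * deriv u x) x := by
    intro x hx
    have hd : HasDerivAt g (deriv g x) x :=
      ((hsm.differentiableOn (by simp)).differentiableAt (hIopen.mem_nhds hx)).hasDerivAt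
    have hg₀ := (hpos x hx).ne'
    rw [hu, (hd.log hg₀).deriv, mul_div_cancel₀ _ hg₀]
    exact hd
  have hu' : ∀ x ∈ I, HasDerivAt (deriv u) (2 * lam * g x) x := by
    intro x hx
    rw [← hcurv x hx]
    have h1 : ContDiffOn ℝ 1 (deriv u) I :=
      hu_smooth.deriv_of_isOpen hIopen (WithTop.coe_le_coe.2 (le_top : (1 + 1 : ℕ∞) ≤ ⊤))
    exact ((h1.differentiableOn (by simp)).differentiableAt (hIopen.mem_nhds hx)).hasDerivAt
  let energy : ℝ → ℝ := fun x => (deriv u x) ^ 2 / 4 - lam * g x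
  have henergy : ∀ x ∈ I, HasDerivAt energy 0 x := by
    intro x hx
    refine ((((hu' x hx).pow 2).div_const 4).sub ((hg x hx).const_mul lam)).congr_deriv ?_
    ring
  set a := energy x₀ with ha
  have hconst : ∀ x ∈ I, (deriv u x) ^ 2 / 4 - lam * g x = a := fun x hx =>
    hIopen.eq_of_hasDerivAt_zero hconn henergy hx hx₀
  have ha_pos : 0 < a := by
    nlinarith [hconst x₀ hx₀, mul_neg_of_neg_of_pos hlam (hpos x₀ hx₀), sq_nonneg (deriv u x₀)]
  have hsq := Real.sq_sqrt ha_pos.le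
  have habs : ∀ x ∈ I, |-(deriv u x) / 2| < Real.sqrt a := by
    intro x hx
    apply Real.lt_sqrt_of_sq_lt
    rw [sq_abs]
    nlinarith [hconst x hx, mul_neg_of_neg_of_pos hlam (hpos x hx)]
  obtain ⟨b, hb⟩ := exists_sq_sub_sq_eq_of_riccati (p := fun x => -(deriv u x) / 2)
    hIopen hconn (s := Real.sqrt a)
    (fun x hx => by linarith [(abs_lt.1 (habs x hx)).1])
    (fun x hx => by linarith [(abs_lt.1 (habs x hx)).2])
    (fun x hx => by
      refine ((hu' x hx).neg.div_const 2).congr_deriv ?_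
      rw [hsq]
      linear_combination hconst x hx)
  refine ⟨a, b, ha_pos, fun x hx => ?_⟩
  have hx' := hb x hx
  have hcosh := Real.cosh_pos (Real.sqrt a * x + b)
  rw [hsq, eq_div_iff (by positivity)] at hx'
  rw [eq_div_iff (mul_ne_zero hlam.ne (by positivity))]
  linear_combination -hx' - Real.cosh (Real.sqrt a * x + b) ^ 2 * hconst x hx
end

section
/- Let c ∈ ℝ and let h_c be the positive function defined by: h_c(θ) = 1/(c·cosh²(θ)) on ℝ if c > 0; h_c(θ) = e^{θ} on ℝ if c = 0; and h_c(θ) = −1/(c·sinh²(θ)) on (−∞,0) if c < 0. Then in each case, (1/(2·h_c(θ)))·(d²/dθ²) ln h_c(θ) = −c for all θ in the domain; that is, the dually flat manifold M_c with metric coefficient h_c has constant Hessian sectional curvature −c. -/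
/-- The metric coefficient of the dually flat model `M_c`. -/
noncomputable def hc (c : ℝ) : ℝ → ℝ := fun θ =>
  if 0 < c then 1 / (c * Real.cosh θ ^ 2)
  else if c = 0 then Real.exp θ
  else -1 / (c * Real.sinh θ ^ 2)

/-- The underlying manifold (interval) of the dually flat model `M_c`. -/
noncomputable def Mc (c : ℝ) : Set ℝ := if c < 0 then Set.Iio 0 else Set.univ

theorem deriv_deriv_eq_of_hasDerivAt {s : Set ℝ} (hs : IsOpen s) {f g : ℝ → ℝ} {a x : ℝ}
    (hx : x ∈ s) (hf : ∀ t ∈ s, HasDerivAt f (g t) t) (hg : HasDerivAt g a x) :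
    deriv (deriv f) x = a := by
  have h : deriv f =ᶠ[nhds x] g := by
    filter_upwards [hs.mem_nhds hx] with t ht using (hf t ht).deriv
  rw [h.deriv_eq, hg.deriv]

theorem hasDerivAt_log_div_mul_sq {k a b t : ℝ} {u : ℝ → ℝ} (hb : b ≠ 0) (ha : a ≠ 0)
    (hut : u t ≠ 0) (hu : HasDerivAt u k t) :
    HasDerivAt (fun t => Real.log (a / (b * u t ^ 2))) (-2 * (k / u t)) t := by
  have hd : b * u t ^ 2 ≠ 0 := mul_ne_zero hb (pow_ne_zero 2 hut)
  have h := ((hasDerivAt_const t a).fun_div ((hu.fun_pow 2).const_mul b) hd).log (div_ne_zero ha hd)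
  convert h using 1
  push_cast
  field_simp
  ring

theorem stmt6 (c : ℝ) : ∀ θ ∈ Mc c,
    1 / (2 * hc c θ) * deriv (deriv (fun t => Real.log (hc c t))) θ = -c := by
  intro θ hθ
  rcases lt_trichotomy c 0 with hneg | rfl | hpos
  · have hθ : θ < 0 := by simpa [Mc, hneg] using hθ
    have hfun : hc c = fun t => -1 / (c * Real.sinh t ^ 2) := by
      funext t
      simp [hc, hneg.not_gt, hneg.ne]
    have hs : ∀ t ∈ Set.Iio (0 : ℝ), Real.sinh t ≠ 0 := fun t ht => (Real.sinh_neg_iff.2 ht).ne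
    have h0 := hs θ hθ
    rw [hfun, deriv_deriv_eq_of_hasDerivAt isOpen_Iio hθ
      (fun t ht => hasDerivAt_log_div_mul_sq hneg.ne (by norm_num) (hs t ht)
        (Real.hasDerivAt_sinh t))
      (((Real.hasDerivAt_cosh θ).fun_div (Real.hasDerivAt_sinh θ) h0).const_mul (-2))]
    have hc0 := hneg.ne
    field_simp
    linear_combination -Real.cosh_sq θ
  · have hfun : hc 0 = Real.exp := by
      funext t
      simp [hc]
    simp [hfun]
  · have hfun : hc c = fun t => 1 / (c * Real.cosh t ^ 2) := by
      funext t
      simp [hc, hpos]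
    have h0 := (Real.cosh_pos θ).ne'
    rw [hfun, deriv_deriv_eq_of_hasDerivAt isOpen_univ (Set.mem_univ θ)
      (fun t _ => hasDerivAt_log_div_mul_sq hpos.ne' one_ne_zero (Real.cosh_pos t).ne'
        (Real.hasDerivAt_cosh t))
      (((Real.hasDerivAt_sinh θ).fun_div (Real.hasDerivAt_cosh θ) h0).const_mul (-2))]
    have hc0 := hpos.ne'
    field_simp
    linear_combination -Real.cosh_sq θ
end

section
/- Let F : ℂ → ℂ² be the map F(z) = (1 + e^{2·Re(z)})^{−1/2}·(e^{z}, 1). Then F is (real) differentiable and for all z, u, v ∈ ℂ, Im⟨DF(z)u, DF(z)v⟩ = (1/(4·cosh²(Re z)))·(Re(u)·Im(v) − Im(u)·Re(v)), where DF(z) denotes the real Fréchet derivative of F at z and ⟨(z₁,z₂),(w₁,w₂)⟩ = conj(z₁)·w₁ + conj(z₂)·w₂ is the standard Hermitian inner product on ℂ². -/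
/-- The map `F(z) = (1 + e^{2 Re z})^{-1/2} · (e^z, 1)` from `ℂ` to `ℂ²`. -/
noncomputable def Fmap (z : ℂ) : ℂ × ℂ :=
  ((Real.sqrt (1 + Real.exp (2 * z.re)))⁻¹ : ℝ) • (Complex.exp z, (1 : ℂ))

theorem hasDerivAt_inv_sqrt_one_add_exp (x : ℝ) :
    HasDerivAt (fun x : ℝ => (Real.sqrt (1 + Real.exp (2 * x)))⁻¹)
      (-Real.exp (2 * x) * (Real.sqrt (1 + Real.exp (2 * x)))⁻¹ ^ 3) x := by
  have hpos : 0 < 1 + Real.exp (2 * x) := by positivity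
  have h := (((((hasDerivAt_id x).const_mul 2).exp).const_add 1).sqrt hpos.ne').inv
    (Real.sqrt_pos.2 hpos).ne'
  refine h.congr_deriv ?_
  have := (Real.sqrt_pos.2 hpos).ne'
  simp only [id]
  field_simp

theorem hasFDerivAt_Fmap (z : ℂ) :
    HasFDerivAt Fmap
      ((Real.sqrt (1 + Real.exp (2 * z.re)))⁻¹ •
          ((Complex.exp z • (1 : ℂ →L[ℝ] ℂ)).prod (0 : ℂ →L[ℝ] ℂ)) +
        ((-Real.exp (2 * z.re) * (Real.sqrt (1 + Real.exp (2 * z.re)))⁻¹ ^ 3) •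
          Complex.reCLM).smulRight (Complex.exp z, (1 : ℂ))) z := by
  have hr := (hasDerivAt_inv_sqrt_one_add_exp z.re).comp_hasFDerivAt z
    Complex.reCLM.hasFDerivAt
  have he : HasFDerivAt Complex.exp (Complex.exp z • (1 : ℂ →L[ℝ] ℂ)) z :=
    (Complex.hasStrictFDerivAt_exp_real z).hasFDerivAt
  exact hr.smul (he.prodMk (hasFDerivAt_const (1 : ℂ) z))

theorem inv_four_mul_cosh_sq (x : ℝ) :
    1 / (4 * Real.cosh x ^ 2) = Real.exp (2 * x) / (1 + Real.exp (2 * x)) ^ 2 := by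
  rw [Real.cosh_eq, Real.exp_neg, two_mul, Real.exp_add]
  have := Real.exp_pos x
  field_simp
  ring

theorem stmt7 :
    Differentiable ℝ Fmap ∧
    ∀ z u v : ℂ,
      ((starRingEnd ℂ) ((fderiv ℝ Fmap z) u).1 * ((fderiv ℝ Fmap z) v).1 +
        (starRingEnd ℂ) ((fderiv ℝ Fmap z) u).2 * ((fderiv ℝ Fmap z) v).2).im =
      1 / (4 * Real.cosh z.re ^ 2) * (u.re * v.im - u.im * v.re) := by
  refine ⟨fun z => (hasFDerivAt_Fmap z).differentiableAt, fun z u v => ?_⟩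
  rw [(hasFDerivAt_Fmap z).fderiv, inv_four_mul_cosh_sq]
  have hE : (Complex.exp z).re ^ 2 + (Complex.exp z).im ^ 2 = Real.exp (2 * z.re) := by
    rw [Complex.exp_re, Complex.exp_im, two_mul, Real.exp_add]
    linear_combination Real.exp z.re ^ 2 * Real.cos_sq_add_sin_sq z.im
  have hpos : 0 < 1 + Real.exp (2 * z.re) := by positivity
  have hg : (Real.sqrt (1 + Real.exp (2 * z.re)))⁻¹ ^ 2 * (1 + Real.exp (2 * z.re)) = 1 := by
    rw [inv_pow, Real.sq_sqrt hpos.le, inv_mul_cancel₀ hpos.ne']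
  generalize (Real.sqrt (1 + Real.exp (2 * z.re)))⁻¹ = g at *
  generalize Real.exp (2 * z.re) = E at *
  have hfrac : E / (1 + E) ^ 2 = E * g ^ 4 := by
    rw [div_eq_iff (by positivity)]
    linear_combination (-E * (g ^ 2 * (1 + E) + 1)) * hg
  rw [hfrac]
  generalize Complex.exp z = w at *
  generalize hc : -E * g ^ 3 = c
  simp
  subst hc
  linear_combination (u.re * v.im - u.im * v.re) * ((g ^ 2 - E * g ^ 4) * hE - E * g ^ 2 * hg)
end

section
/- Let Ω = {0,1,…,m} (m ≥ 1) and let C, F, C', F' : Ω → ℝ with F and F' nonconstant. Then the exponential families E_{C,F} and E_{C',F'} are equivalent (i.e., {p_{C,F}(·;θ) : θ ∈ ℝ} = {p_{C',F'}(·;θ) : θ ∈ ℝ} as sets of functions Ω → ℝ) if and only if there exist real numbers a, b, c, d with a ≠ 0 such that C(x) = C'(x) + b·F'(x) + d and F(x) = a·F'(x) + c for all x ∈ Ω. -/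
/-- Log-partition function of the exponential family `E_{C,F}` over `{0,...,n}`. -/
noncomputable def psi {n : ℕ} (C F : Fin (n + 1) → ℝ) (θ : ℝ) : ℝ :=
  Real.log (∑ x, Real.exp (C x + θ * F x))

/-- The probability function of the exponential family `E_{C,F}` with parameter `θ`. -/
noncomputable def pfun {n : ℕ} (C F : Fin (n + 1) → ℝ) (θ : ℝ) : Fin (n + 1) → ℝ :=
  fun x => Real.exp (C x + θ * F x - psi C F θ)

/-- Two members of exponential families agree iff their exponents differ by a constant. -/
theorem pfun_eq_pfun_iff {n : ℕ} (C F C' F' : Fin (n + 1) → ℝ) (θ η : ℝ) :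
    pfun C F θ = pfun C' F' η ↔ ∃ k, ∀ x, C x + θ * F x = C' x + η * F' x + k := by
  constructor
  · intro h
    refine ⟨psi C F θ - psi C' F' η, fun x => ?_⟩
    have hx := Real.exp_injective (congrFun h x)
    linarith
  · rintro ⟨k, hk⟩
    have hpsi : psi C F θ = psi C' F' η + k := by
      have hpos : 0 < ∑ x, Real.exp (C' x + η * F' x) :=
        Finset.sum_pos (fun x _ => Real.exp_pos _) Finset.univ_nonempty
      simp only [psi, hk, Real.exp_add _ k, ← Finset.sum_mul]
      rw [Real.log_mul hpos.ne' (Real.exp_ne_zero k), Real.log_exp]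
    funext x
    simp only [pfun, hpsi, hk]
    ring_nf

theorem stmt9 (m : ℕ) (hm : 1 ≤ m) (C F C' F' : Fin (m + 1) → ℝ)
    (hF : ∃ x y, F x ≠ F y) (hF' : ∃ x y, F' x ≠ F' y) :
    Set.range (pfun C F) = Set.range (pfun C' F') ↔
      ∃ a b c d : ℝ, a ≠ 0 ∧
        ∀ x, C x = C' x + b * F' x + d ∧ F x = a * F' x + c := by
  constructor
  · intro h
    obtain ⟨b, hb⟩ := h.subset (Set.mem_range_self 0)
    obtain ⟨e, he⟩ := h.subset (Set.mem_range_self 1)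
    obtain ⟨d, hd⟩ := (pfun_eq_pfun_iff _ _ _ _ _ _).1 hb.symm
    obtain ⟨k, hk⟩ := (pfun_eq_pfun_iff _ _ _ _ _ _).1 he.symm
    have hlin : ∀ x, F x = (e - b) * F' x + (k - d) := fun x => by
      linarith [hd x, hk x]
    refine ⟨e - b, b, k - d, d, ?_, fun x => ⟨by linarith [hd x], hlin x⟩⟩
    intro ha
    obtain ⟨x, y, hxy⟩ := hF
    exact hxy (by rw [hlin x, hlin y, ha]; ring)
  · rintro ⟨a, b, c, d, ha, h⟩
    have key : ∀ θ, pfun C F θ = pfun C' F' (b + θ * a) := fun θ =>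
      (pfun_eq_pfun_iff _ _ _ _ _ _).2
        ⟨d + θ * c, fun x => by rw [(h x).1, (h x).2]; ring⟩
    apply Set.Subset.antisymm
    · rintro _ ⟨θ, rfl⟩
      exact ⟨b + θ * a, (key θ).symm⟩
    · rintro _ ⟨η, rfl⟩
      exact ⟨(η - b) / a, by rw [key, div_mul_cancel₀ _ ha, add_sub_cancel]⟩
end

section
/- Let Ω = {0,1,…,m} and let C, F : Ω → ℝ with F nonconstant, and let p + 1 be the number of distinct values of F. Define the Hessian sectional curvature S_{C,F}(θ) = (d²/dθ² ln ψ''_{C,F}(θ))/(2·ψ''_{C,F}(θ)). Then S_{C,F} is a constant function of θ if and only if the reduced exponential family E_{C_red,F_red} is equivalent to the binomial family B(p) (i.e., the sets of probability functions {p_{C_red,F_red}(·;θ) : θ ∈ ℝ} and {p_{C_B,F_B}(·;θ) : θ ∈ ℝ} on {0,…,p} coincide, where C_B(k) = ln(p choose k) and F_B(k) = k). Moreover, if S_{C,F} is constant, then S_{C,F}(θ) = −1/p for all θ ∈ ℝ. -/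
/-- Hessian sectional curvature of a 1-dimensional exponential family with
log-partition function `ψ`, in the natural parameter. -/
noncomputable def hessCurv (ψ : ℝ → ℝ) (θ : ℝ) : ℝ :=
  deriv (deriv (fun t => Real.log (deriv (deriv ψ) t))) θ / (2 * deriv (deriv ψ) θ)

/-- The exponential sum with coefficients `c` and frequencies `a`. -/
noncomputable def expSum {ι : Type*} [Fintype ι] (c a : ι → ℝ) (θ : ℝ) : ℝ :=
  ∑ k, c k * Real.exp (a k * θ)

theorem hasDerivAt_expSum {ι : Type*} [Fintype ι] (c a : ι → ℝ) (θ : ℝ) :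
    HasDerivAt (expSum c a) (expSum (fun k => c k * a k) a θ) θ := by
  have h : ∀ k ∈ (Finset.univ : Finset ι), HasDerivAt (fun t => c k * Real.exp (a k * t))
      (c k * a k * Real.exp (a k * θ)) θ := by
    intro k _
    have h1 : HasDerivAt (fun t => a k * t) (a k) θ := by
      simpa using (hasDerivAt_id θ).const_mul (a k)
    exact (h1.exp.const_mul (c k)).congr_deriv (by ring)
  exact HasDerivAt.fun_sum h

theorem expSum_pos {ι : Type*} [Fintype ι] {c : ι → ℝ} (a : ι → ℝ) (θ : ℝ)
    (hc : ∀ k, 0 ≤ c k) (hc' : ∃ k, 0 < c k) : 0 < expSum c a θ :=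
  Finset.sum_pos' (fun k _ => mul_nonneg (hc k) (Real.exp_pos _).le)
    (hc'.imp fun _ hk => ⟨Finset.mem_univ _, mul_pos hk (Real.exp_pos _)⟩)

theorem contDiff_expSum {ι : Type*} [Fintype ι] (c a : ι → ℝ) {n : WithTop ℕ∞} :
    ContDiff ℝ n (expSum c a) := by
  unfold expSum
  fun_prop

/-- The extremal frequency of an exponential sum dominates. -/
theorem tendsto_expSum_mul_exp {ι : Type*} [Fintype ι] (c a : ι → ℝ) (j : ι)
    {l : Filter ℝ} (h : ∀ k ≠ j, Filter.Tendsto (fun θ => (a k - a j) * θ) l Filter.atBot) :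
    Filter.Tendsto (fun θ => expSum c a θ * Real.exp (-(a j * θ))) l (nhds (c j)) := by
  classical
  have key : ∀ k ∈ (Finset.univ : Finset ι),
      Filter.Tendsto (fun θ => c k * Real.exp ((a k - a j) * θ)) l
        (nhds (if k = j then c k else 0)) := by
    intro k _
    by_cases hk : k = j
    · subst hk
      simpa using tendsto_const_nhds
    · simpa [hk] using (Real.tendsto_exp_atBot.comp (h k hk)).const_mul (c k)
  have := tendsto_finsetSum _ key
  simp only [Finset.sum_ite_eq', Finset.mem_univ, if_true] at this
  refine this.congr fun θ => ?_
  rw [expSum, Finset.sum_mul]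
  refine Finset.sum_congr rfl fun k _ => ?_
  rw [mul_assoc, ← Real.exp_add]
  ring_nf

/-- Exponentials with distinct frequencies are linearly independent. -/
theorem linearIndependent_exp_mul :
    LinearIndependent ℝ (fun a : ℝ => fun θ : ℝ => Real.exp (a * θ)) := by
  let χ : ℝ → (Multiplicative ℝ →* ℝ) := fun a =>
    { toFun := fun t => Real.exp (a * t.toAdd)
      map_one' := by simp
      map_mul' := fun x y => by simp [mul_add, Real.exp_add] }
  have hχ : Function.Injective χ := by
    intro a b hab
    have := DFunLike.congr_fun hab (Multiplicative.ofAdd 1)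
    simpa [χ] using this
  exact (linearIndependent_monoidHom (Multiplicative ℝ) ℝ).comp χ hχ

/-- Two exponential sums with nonzero coefficients and increasing frequencies that agree as
functions have the same frequencies and the same coefficients. -/
theorem expSum_inj {n : ℕ} {c d a b : Fin n → ℝ} (ha : StrictMono a) (hb : StrictMono b)
    (hc : ∀ k, c k ≠ 0) (hd : ∀ k, d k ≠ 0) (h : ∀ θ, expSum c a θ = expSum d b θ) :
    a = b ∧ c = d := by
  classical
  let S : (Fin n → ℝ) → (Fin n → ℝ) → (ℝ →₀ ℝ) := fun c a => ∑ k, Finsupp.single (a k) (c k)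
  have hS : S c a = S d b := by
    apply linearIndependent_exp_mul
    ext θ
    simpa [S, map_sum, Finsupp.linearCombination_single, expSum] using h θ
  have hval : ∀ (c a : Fin n → ℝ), StrictMono a → ∀ k, S c a (a k) = c k := by
    intro c a ha k
    simp [S, Finsupp.finsetSum_apply, Finsupp.single_apply, ha.injective.eq_iff]
  have hsub : ∀ (c a : Fin n → ℝ) (x : ℝ), S c a x ≠ 0 → x ∈ Set.range a := by
    intro c a x hx
    by_contra hxa
    apply hx
    simp only [S, Finsupp.finsetSum_apply]
    refine Finset.sum_eq_zero fun k _ => ?_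
    exact Finsupp.single_eq_of_ne fun hk => hxa ⟨k, hk.symm⟩
  have hab : a = b := by
    rw [← ha.range_inj hb]
    apply Set.Subset.antisymm
    · rintro _ ⟨k, rfl⟩
      exact hsub d b _ (by rw [← hS, hval c a ha]; exact hc k)
    · rintro _ ⟨k, rfl⟩
      exact hsub c a _ (by rw [hS, hval d b hb]; exact hd k)
  refine ⟨hab, ?_⟩
  subst hab
  ext k
  rw [← hval c a ha k, hS, hval d a ha k]

theorem psi_eq_log_expSum {n : ℕ} (C F : Fin (n + 1) → ℝ) :
    psi C F = fun θ => Real.log (expSum (fun k => Real.exp (C k)) F θ) := by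
  ext θ
  simp only [psi, expSum, ← Real.exp_add, mul_comm θ]

/-- The log-partition function only depends on the reduced family. -/
theorem psi_eq_psi_reduced {m p : ℕ} {C F : Fin (m + 1) → ℝ} {α ω : Fin (p + 1) → ℝ}
    (hα : StrictMono α) (hrange : Set.range α = Set.range F)
    (hω : ∀ k, Real.exp (ω k) = ∑ x, if F x = α k then Real.exp (C x) else 0) :
    psi C F = psi ω α := by
  ext θ
  simp only [psi]
  congr 1
  simp only [Real.exp_add, hω, Finset.sum_mul]
  rw [Finset.sum_comm]
  refine Finset.sum_congr rfl fun x _ => ?_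
  obtain ⟨j, hj⟩ : F x ∈ Set.range α := hrange ▸ Set.mem_range_self x
  rw [Finset.sum_eq_single j]
  · simp [hj]
  · intro k _ hk
    rw [if_neg, zero_mul]
    rw [← hj]
    exact fun h => hk (hα.injective h).symm
  · simp

/-- Affinely related exponents that differ by a constant give the same probability function. -/
theorem pfun_congr {n : ℕ} {C F C' F' : Fin (n + 1) → ℝ} {θ θ' c : ℝ}
    (h : ∀ x, C x + θ * F x = C' x + θ' * F' x + c) : pfun C F θ = pfun C' F' θ' := by
  have hpos : 0 < ∑ x, Real.exp (C' x + θ' * F' x) :=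
    Finset.sum_pos (fun _ _ => Real.exp_pos _) Finset.univ_nonempty
  have hpsi : psi C F θ = psi C' F' θ' + c := by
    simp only [psi, h]
    simp only [Real.exp_add _ c]
    rw [← Finset.sum_mul, Real.log_mul hpos.ne' (Real.exp_pos c).ne', Real.log_exp]
  ext x
  simp only [pfun, h, hpsi]
  congr 1
  ring

/-- A family with the same probability functions as the binomial family has a log-partition
function that is affinely related to the binomial one. -/
theorem exists_psi_eq_of_range_pfun_eq {p : ℕ} (hp : p ≠ 0) {α ω : Fin (p + 1) → ℝ}
    (hα : StrictMono α)
    (h : Set.range (pfun ω α) =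
        Set.range (pfun (fun k => Real.log (Nat.choose p (k : ℕ) : ℝ)) (fun k => ((k : ℕ) : ℝ)))) :
    ∃ A B η q : ℝ, q ≠ 0 ∧
      psi ω α = fun θ => A + B * θ + p * Real.log (1 + Real.exp (η + q * θ)) := by
  obtain ⟨η, hη⟩ := h ▸ Set.mem_range_self (f := pfun ω α) 0
  obtain ⟨η', hη'⟩ := h ▸ Set.mem_range_self (f := pfun ω α) 1
  have e0 : ∀ k : Fin (p + 1), Real.log (Nat.choose p (k : ℕ) : ℝ) + η * ((k : ℕ) : ℝ) - _ = _ :=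
    fun k => Real.exp_injective (congrFun hη k)
  have e1 : ∀ k : Fin (p + 1), Real.log (Nat.choose p (k : ℕ) : ℝ) + η' * ((k : ℕ) : ℝ) - _ = _ :=
    fun k => Real.exp_injective (congrFun hη' k)
  simp only [zero_mul, add_zero, one_mul] at e0 e1
  generalize psi _ _ η = b0 at e0
  generalize psi _ _ η' = b1 at e1
  generalize psi ω α 0 = a0 at e0
  generalize psi ω α 1 = a1 at e1
  have hωk : ∀ k : Fin (p + 1),
      ω k = Real.log (Nat.choose p (k : ℕ) : ℝ) + η * ((k : ℕ) : ℝ) + (a0 - b0) :=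
    fun k => by linarith [e0 k]
  have hαk : ∀ k : Fin (p + 1), α k = (η' - η) * ((k : ℕ) : ℝ) + (a1 - b1 - a0 + b0) :=
    fun k => by linarith [e0 k, e1 k]
  refine ⟨a0 - b0, a1 - b1 - a0 + b0, η, η' - η, ?_, ?_⟩
  · intro hq
    have hlt : α 0 < α (Fin.last p) := hα (Fin.lt_def.2 (by simpa using Nat.pos_of_ne_zero hp))
    rw [hαk 0, hαk (Fin.last p), hq] at hlt
    simp at hlt
  · ext θ
    have hsum : ∑ k, Real.exp (ω k + θ * α k) =
        Real.exp (a0 - b0 + (a1 - b1 - a0 + b0) * θ) *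
          (1 + Real.exp (η + (η' - η) * θ)) ^ p := by
      rw [add_comm (1 : ℝ), add_pow, Finset.mul_sum,
        ← Fin.sum_univ_eq_sum_range (fun k => Real.exp (a0 - b0 + (a1 - b1 - a0 + b0) * θ) *
          (Real.exp (η + (η' - η) * θ) ^ k * 1 ^ (p - k) * (p.choose k : ℝ))) (p + 1)]
      refine Finset.sum_congr rfl fun k _ => ?_
      have hch : (0 : ℝ) < p.choose k := by
        exact_mod_cast Nat.choose_pos (Nat.lt_succ_iff.1 k.2)
      rw [one_pow, mul_one, ← Real.exp_nat_mul, hωk, hαk]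
      conv_rhs => rw [← Real.exp_log hch]
      rw [← Real.exp_add, ← Real.exp_add]
      congr 1
      ring
    rw [psi, hsum, Real.log_mul (Real.exp_pos _).ne' (by positivity), Real.log_exp, Real.log_pow]

/-- The log-partition function `p * log (1 + exp (η + q * θ))`, up to affine terms, has constant
Hessian curvature `-1 / p`. -/
theorem hessCurv_binomial {p : ℝ} (hp : 0 < p) (A B η q θ : ℝ) (hq : q ≠ 0) :
    hessCurv (fun θ => A + B * θ + p * Real.log (1 + Real.exp (η + q * θ))) θ = -(1 / p) := by
  have hx : ∀ t, HasDerivAt (fun t => Real.exp (η + q * t)) (q * Real.exp (η + q * t)) t := by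
    intro t
    have h1 : HasDerivAt (fun t => η + q * t) q t := by
      simpa using ((hasDerivAt_id t).const_mul q).const_add η
    exact h1.exp.congr_deriv (by ring)
  have hpos : ∀ t, 0 < 1 + Real.exp (η + q * t) := fun t => by positivity
  have hx1 : ∀ t, HasDerivAt (fun t => 1 + Real.exp (η + q * t)) (q * Real.exp (η + q * t)) t :=
    fun t => (hx t).const_add 1
  have hlog : ∀ t, HasDerivAt (fun t => Real.log (1 + Real.exp (η + q * t)))
      (q * Real.exp (η + q * t) / (1 + Real.exp (η + q * t))) t :=
    fun t => (hx1 t).log (hpos t).ne'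
  have hfrac : ∀ t, HasDerivAt (fun t => q * Real.exp (η + q * t) / (1 + Real.exp (η + q * t)))
      (q ^ 2 * Real.exp (η + q * t) / (1 + Real.exp (η + q * t)) ^ 2) t := by
    intro t
    exact (((hx t).const_mul q).fun_div (hx1 t) (hpos t).ne').congr_deriv (by ring)
  have d1 : deriv (fun θ => A + B * θ + p * Real.log (1 + Real.exp (η + q * θ))) =
      fun t => B + p * (q * Real.exp (η + q * t) / (1 + Real.exp (η + q * t))) := by
    ext t
    have h1 : HasDerivAt (fun t => A + B * t) B t := by
      simpa using ((hasDerivAt_id t).const_mul B).const_add A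
    exact (h1.add ((hlog t).const_mul p)).deriv
  have d2 : deriv (deriv (fun θ => A + B * θ + p * Real.log (1 + Real.exp (η + q * θ)))) =
      fun t => p * (q ^ 2 * Real.exp (η + q * t) / (1 + Real.exp (η + q * t)) ^ 2) := by
    ext t
    rw [d1]
    exact (((hfrac t).const_mul p).const_add B).deriv
  have d3 : (fun t => Real.log
        (p * (q ^ 2 * Real.exp (η + q * t) / (1 + Real.exp (η + q * t)) ^ 2))) =
      fun t => Real.log (p * q ^ 2) + η + q * t - 2 * Real.log (1 + Real.exp (η + q * t)) := by
    ext t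
    have := hpos t
    rw [← mul_div_assoc, ← mul_assoc, Real.log_div (by positivity) (by positivity),
      Real.log_mul (by positivity) (by positivity), Real.log_exp, Real.log_pow]
    push_cast
    ring
  have d4 : deriv (fun t => Real.log (p * q ^ 2) + η + q * t
      - 2 * Real.log (1 + Real.exp (η + q * t))) =
      fun t => q - 2 * (q * Real.exp (η + q * t) / (1 + Real.exp (η + q * t))) := by
    ext t
    have h1 : HasDerivAt (fun t => Real.log (p * q ^ 2) + η + q * t) q t := by
      simpa using ((hasDerivAt_id t).const_mul q).const_add (Real.log (p * q ^ 2) + η)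
    exact (h1.sub ((hlog t).const_mul 2)).deriv
  rw [hessCurv, d2, d3, d4, (((hfrac θ).const_mul 2).const_sub q).deriv]
  have := hpos θ
  have := Real.exp_pos (η + q * θ)
  field_simp

/-- Constant Hessian curvature of a smooth strictly convex potential gives a Riccati equation
for its derivative. -/
theorem exists_riccati_of_hessCurv_eq {ψ : ℝ → ℝ} {s : ℝ} (hψ : ContDiff ℝ 4 ψ)
    (hpos : ∀ t, 0 < deriv (deriv ψ) t) (hs : ∀ t, hessCurv ψ t = s) :
    ∃ b c : ℝ, ∀ t, deriv (deriv ψ) t = s * deriv ψ t ^ 2 + b * deriv ψ t + c := by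
  have h1 : ContDiff ℝ 3 (deriv ψ) := ContDiff.deriv' (n := 3) (by norm_num; exact hψ)
  have h2 : ContDiff ℝ 2 (deriv (deriv ψ)) := ContDiff.deriv' (n := 2) (by norm_num; exact h1)
  have hu : ∀ t, HasDerivAt (deriv ψ) (deriv (deriv ψ) t) t :=
    fun t => (h1.differentiable (by norm_num) t).hasDerivAt
  have hg : ∀ t, HasDerivAt (deriv (deriv ψ)) (deriv (deriv (deriv ψ)) t) t :=
    fun t => (h2.differentiable (by norm_num) t).hasDerivAt
  have hl : ContDiff ℝ 2 (fun t => Real.log (deriv (deriv ψ) t)) :=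
    h2.log fun t => (hpos t).ne'
  have hl1 : ContDiff ℝ 1 (deriv fun t => Real.log (deriv (deriv ψ) t)) := ContDiff.deriv' (n := 1) (by norm_num; exact hl)
  have hh : ∀ t, HasDerivAt (deriv fun t => Real.log (deriv (deriv ψ) t))
      (2 * s * deriv (deriv ψ) t) t := by
    intro t
    refine (hl1.differentiable (by norm_num) t).hasDerivAt.congr_deriv ?_
    have := hs t
    rw [hessCurv, div_eq_iff (mul_pos two_pos (hpos t)).ne'] at this
    rw [this]
    ring
  obtain ⟨b, hb⟩ : ∃ b, ∀ t, deriv (fun t => Real.log (deriv (deriv ψ) t)) t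
      - 2 * s * deriv ψ t = b := by
    have hd : ∀ t, HasDerivAt (fun t => deriv (fun t => Real.log (deriv (deriv ψ) t)) t
        - 2 * s * deriv ψ t) 0 t :=
      fun t => ((hh t).sub ((hu t).const_mul (2 * s))).congr_deriv (by ring)
    exact ⟨_, fun t => is_const_of_deriv_eq_zero (fun t => (hd t).differentiableAt)
      (fun t => (hd t).deriv) t 0⟩
  obtain ⟨c, hc⟩ : ∃ c, ∀ t, deriv (deriv ψ) t - (s * deriv ψ t ^ 2 + b * deriv ψ t) = c := by
    have hd : ∀ t, HasDerivAt (fun t => deriv (deriv ψ) t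
        - (s * deriv ψ t ^ 2 + b * deriv ψ t)) 0 t := by
      intro t
      refine ((hg t).sub ((((hu t).fun_pow 2).const_mul s).add ((hu t).const_mul b))).congr_deriv ?_
      have h3 := hb t
      rw [((hg t).log (hpos t).ne').deriv, sub_eq_iff_eq_add, div_eq_iff (hpos t).ne'] at h3
      rw [h3]
      push_cast
      ring
    exact ⟨_, fun t => is_const_of_deriv_eq_zero (fun t => (hd t).differentiableAt)
      (fun t => (hd t).deriv) t 0⟩
  exact ⟨b, c, fun t => by linarith [hc t]⟩

/-- A family of constant Hessian curvature has frequencies in arithmetic progression and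
weights given by binomial coefficients up to a geometric factor. -/
theorem binomial_of_hessCurv_eq {p : ℕ} (hp : p ≠ 0) {α ω : Fin (p + 1) → ℝ}
    (hα : StrictMono α) {s : ℝ} (hs : ∀ θ, hessCurv (psi ω α) θ = s) :
    s = -(1 / (p : ℝ)) ∧ ∃ r K : ℝ, r ≠ 0 ∧ 0 < K ∧
      ∀ k : Fin (p + 1), α k = α 0 + (k : ℕ) * r ∧
        Real.exp (ω k) = Real.exp (ω 0) * (p.choose k : ℝ) * K ^ (k : ℕ) := by
  set a : Fin (p + 1) → ℝ := fun k => Real.exp (ω k) with ha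
  have hapos : ∀ k, 0 < a k := fun k => Real.exp_pos _
  set Z := expSum a α with hZ
  set Z₁ := expSum (fun k => a k * α k) α with hZ₁
  set Z₂ := expSum (fun k => a k * α k * α k) α with hZ₂
  have hlt : α 0 < α (Fin.last p) := hα (Fin.lt_def.2 (by simpa using Nat.pos_of_ne_zero hp))
  have hZpos : ∀ t, 0 < Z t := fun t => expSum_pos _ _ (fun k => (hapos k).le) ⟨0, hapos 0⟩
  have dZ : ∀ t, HasDerivAt Z (Z₁ t) t := hasDerivAt_expSum a α
  have dZ₁ : ∀ t, HasDerivAt Z₁ (Z₂ t) t := hasDerivAt_expSum _ α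
  have hψ : psi ω α = fun t => Real.log (Z t) := psi_eq_log_expSum ω α
  have hψsmooth : ContDiff ℝ 4 (psi ω α) := by
    rw [hψ]
    exact (contDiff_expSum a α).log fun t => (hZpos t).ne'
  have hψ1 : deriv (psi ω α) = fun t => Z₁ t / Z t := by
    ext t
    rw [hψ]
    exact ((dZ t).log (hZpos t).ne').deriv
  have hψ2 : deriv (deriv (psi ω α)) = fun t => (Z₂ t * Z t - Z₁ t * Z₁ t) / Z t ^ 2 := by
    ext t
    rw [hψ1]
    exact ((dZ₁ t).fun_div (dZ t) (hZpos t).ne').deriv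
  have hψ2pos : ∀ t, 0 < deriv (deriv (psi ω α)) t := by
    intro t
    have hvar : 0 < expSum (fun k => a k * (α k - Z₁ t / Z t) ^ 2) α t := by
      refine expSum_pos _ _ (fun k => mul_nonneg (hapos k).le (sq_nonneg _)) ?_
      by_contra! hcon
      have hz : ∀ k, α k = Z₁ t / Z t := by
        intro k
        have h1 := le_of_mul_le_mul_left ((hcon k).trans_eq (mul_zero (a k)).symm) (hapos k)
        exact sub_eq_zero.1 (pow_eq_zero_iff two_ne_zero |>.1 (le_antisymm h1 (sq_nonneg _)))
      exact hlt.ne ((hz 0).trans (hz _).symm)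
    have hexp : ∀ u : ℝ, expSum (fun k => a k * (α k - u) ^ 2) α t =
        Z₂ t - 2 * u * Z₁ t + u ^ 2 * Z t := by
      intro u
      simp only [hZ, hZ₁, hZ₂, expSum, Finset.mul_sum, ← Finset.sum_add_distrib,
        ← Finset.sum_sub_distrib]
      exact Finset.sum_congr rfl fun k _ => by ring
    rw [hψ2]
    have h0 := hZpos t
    have : (Z₂ t * Z t - Z₁ t * Z₁ t) / Z t ^ 2 =
        expSum (fun k => a k * (α k - Z₁ t / Z t) ^ 2) α t / Z t := by
      rw [hexp]
      field_simp
      ring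
    simp only [this]
    positivity
  obtain ⟨b, c, hbc⟩ := exists_riccati_of_hessCurv_eq hψsmooth hψ2pos hs
  have hric : ∀ t, Z₂ t * Z t - Z₁ t * Z₁ t = s * Z₁ t ^ 2 + b * (Z₁ t * Z t) + c * Z t ^ 2 := by
    intro t
    have h := hbc t
    have h0 := (hZpos t).ne'
    rw [hψ2, hψ1] at h
    field_simp at h
    linarith
  have hroot : ∀ (j : Fin (p + 1)) (l : Filter ℝ) [l.NeBot],
      (∀ k ≠ j, Filter.Tendsto (fun θ => (α k - α j) * θ) l Filter.atBot) →
      s * α j ^ 2 + b * α j + c = 0 := by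
    intro j l _ hl
    have t0 := tendsto_expSum_mul_exp a α j hl
    have t1 := tendsto_expSum_mul_exp (fun k => a k * α k) α j hl
    have t2 := tendsto_expSum_mul_exp (fun k => a k * α k * α k) α j hl
    have hL := (t2.mul t0).sub (t1.mul t1)
    have hR := (((t1.pow 2).const_mul s).add ((t1.mul t0).const_mul b)).add ((t0.pow 2).const_mul c)
    have := tendsto_nhds_unique hL (hR.congr fun t => by
      have := hric t
      simp only [hZ, hZ₁, hZ₂] at this
      linear_combination (-Real.exp (-(α j * t)) ^ 2) * this)
    have h2 : a j ^ 2 * (s * α j ^ 2 + b * α j + c) = 0 := by linear_combination -this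
    exact (mul_eq_zero.1 h2).resolve_left (pow_pos (hapos j) 2).ne'
  have r0 : s * α 0 ^ 2 + b * α 0 + c = 0 := by
    refine hroot 0 Filter.atBot fun k hk => ?_
    exact Filter.tendsto_id.const_mul_atBot (sub_pos.2 (hα (Fin.pos_of_ne_zero hk)))
  have rp : s * α (Fin.last p) ^ 2 + b * α (Fin.last p) + c = 0 := by
    refine hroot (Fin.last p) Filter.atTop fun k hk => ?_
    exact Filter.tendsto_id.const_mul_atTop_of_neg (sub_neg.2 (hα (Fin.lt_last_iff_ne_last.2 hk)))
  have hb : b = -(s * (α 0 + α (Fin.last p))) := by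
    have : (α (Fin.last p) - α 0) * (b + s * (α 0 + α (Fin.last p))) = 0 := by
      linear_combination rp - r0
    linarith [(mul_eq_zero.1 this).resolve_left (sub_pos.2 hlt).ne']
  have hc : c = s * (α 0 * α (Fin.last p)) := by
    linear_combination r0 - α 0 * hb
  set r := -(s * (α (Fin.last p) - α 0)) with hr
  let X : ℝ → ℝ := fun t => Z₁ t - α 0 * Z t
  let Y : ℝ → ℝ := fun t => α (Fin.last p) * Z t - Z₁ t
  have hXe : ∀ t, X t = expSum (fun k => a k * (α k - α 0)) α t := by
    intro t
    simp only [X, hZ, hZ₁, expSum, Finset.mul_sum, ← Finset.sum_sub_distrib]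
    exact Finset.sum_congr rfl fun k _ => by ring
  have hYe : ∀ t, Y t = expSum (fun k => a k * (α (Fin.last p) - α k)) α t := by
    intro t
    simp only [Y, hZ, hZ₁, expSum, Finset.mul_sum, ← Finset.sum_sub_distrib]
    exact Finset.sum_congr rfl fun k _ => by ring
  have hXpos : ∀ t, 0 < X t := fun t => by
    rw [hXe]
    exact expSum_pos _ _ (fun k => mul_nonneg (hapos k).le
      (sub_nonneg.2 (hα.monotone (Fin.zero_le k)))) ⟨Fin.last p, mul_pos (hapos _) (sub_pos.2 hlt)⟩
  have hYpos : ∀ t, 0 < Y t := fun t => by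
    rw [hYe]
    exact expSum_pos _ _ (fun k => mul_nonneg (hapos k).le
      (sub_nonneg.2 (hα.monotone (Fin.le_last k)))) ⟨0, mul_pos (hapos _) (sub_pos.2 hlt)⟩
  obtain ⟨K, hK⟩ : ∃ K, ∀ t, X t / Y t * Real.exp (-r * t) = K := by
    have hd : ∀ t, HasDerivAt (fun t => X t / Y t * Real.exp (-r * t)) 0 t := by
      intro t
      have dX : HasDerivAt X (Z₂ t - α 0 * Z₁ t) t := (dZ₁ t).sub ((dZ t).const_mul _)
      have dY : HasDerivAt Y (α (Fin.last p) * Z₁ t - Z₂ t) t :=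
        ((dZ t).const_mul _).sub (dZ₁ t)
      have de : HasDerivAt (fun t => Real.exp (-r * t)) (-r * Real.exp (-r * t)) t := by
        have h1 : HasDerivAt (fun t => -r * t) (-r) t := by
          simpa using (hasDerivAt_id t).const_mul (-r)
        exact h1.exp.congr_deriv (by ring)
      refine ((dX.fun_div dY (hYpos t).ne').mul de).congr_deriv ?_
      have hnum : (Z₂ t - α 0 * Z₁ t) * Y t - X t * (α (Fin.last p) * Z₁ t - Z₂ t) =
          r * (X t * Y t) := by
        have := hric t
        rw [hb, hc] at this
        simp only [X, Y, hr]
        linear_combination (α (Fin.last p) - α 0) * this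
      have := (hYpos t).ne'
      rw [hnum]
      field_simp
      ring
    exact ⟨_, fun t => is_const_of_deriv_eq_zero (fun t => (hd t).differentiableAt)
      (fun t => (hd t).deriv) t 0⟩
  have hKpos : 0 < K := by
    rw [← hK 0]
    exact mul_pos (div_pos (hXpos 0) (hYpos 0)) (Real.exp_pos _)
  have hXY : ∀ t, X t = K * Real.exp (r * t) * Y t := by
    intro t
    have h1 : Real.exp (-r * t) * Real.exp (r * t) = 1 := by
      rw [← Real.exp_add]
      simp
    have := (hYpos t).ne'
    calc X t = X t / Y t * Y t * (Real.exp (-r * t) * Real.exp (r * t)) := by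
          rw [h1, mul_one, div_mul_cancel₀ _ this]
      _ = (X t / Y t * Real.exp (-r * t)) * Real.exp (r * t) * Y t := by ring
      _ = _ := by rw [hK]
  obtain ⟨hfreq, hcoef⟩ := expSum_inj (n := p)
    (c := fun k => a k.succ * (α k.succ - α 0)) (a := fun k => α k.succ)
    (d := fun k => K * (a k.castSucc * (α (Fin.last p) - α k.castSucc)))
    (b := fun k => α k.castSucc + r)
    (fun i j hij => hα (Fin.succ_lt_succ_iff.2 hij))
    (fun i j hij => add_lt_add_left (hα (Fin.castSucc_lt_castSucc_iff.2 hij)) r)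
    (fun k => (mul_pos (hapos _) (sub_pos.2 (hα (Fin.succ_pos k)))).ne')
    (fun k => (mul_pos hKpos (mul_pos (hapos _) (sub_pos.2 (hα (Fin.castSucc_lt_last k))))).ne')
    (fun t => by
      have h := hXY t
      rw [hXe, hYe, expSum, expSum, Fin.sum_univ_succ, Fin.sum_univ_castSucc] at h
      simp only [sub_self, mul_zero, zero_mul, zero_add, add_zero, Finset.mul_sum] at h
      rw [expSum, expSum, h]
      refine Finset.sum_congr rfl fun k _ => ?_
      rw [add_mul, Real.exp_add]
      ring)
  have hstep : ∀ k : Fin p, α k.succ = α k.castSucc + r := fun k => congrFun hfreq k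
  have hcstep : ∀ k : Fin p, a k.succ * (α k.succ - α 0) =
      K * (a k.castSucc * (α (Fin.last p) - α k.castSucc)) := fun k => congrFun hcoef k
  have hαk : ∀ k : Fin (p + 1), α k = α 0 + (k : ℕ) * r := by
    intro k
    induction k using Fin.induction with
    | zero => simp
    | succ k ih =>
      rw [hstep, ih]
      simp only [Fin.val_castSucc, Fin.val_succ]
      push_cast
      ring
  have hlast : α (Fin.last p) - α 0 = p * r := by
    rw [hαk (Fin.last p)]
    simp
  have hp' : (p : ℝ) ≠ 0 := Nat.cast_ne_zero.2 hp
  have hr0 : r ≠ 0 := by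
    intro h0
    rw [h0, mul_zero] at hlast
    exact (sub_pos.2 hlt).ne' hlast
  refine ⟨?_, r, K, hr0, hKpos, fun k => ⟨hαk k, ?_⟩⟩
  · have h1 : r * (1 + s * p) = 0 := by
      rw [hlast] at hr
      linear_combination hr
    have h2 := (mul_eq_zero.1 h1).resolve_left hr0
    field_simp
    linarith
  · change a k = a 0 * _ * _
    induction k using Fin.induction with
    | zero => simp
    | succ k ih =>
      have h := hcstep k
      rw [ih, hαk k.succ, hαk (Fin.last p), hαk k.castSucc] at h
      have hch : (p.choose (k + 1) : ℝ) * ((k : ℕ) + 1) = p.choose k * ((p : ℝ) - (k : ℕ)) := by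
        rw [← Nat.cast_sub k.2.le]
        exact_mod_cast Nat.choose_succ_right_eq p k
      simp only [Fin.val_castSucc, Fin.val_succ, Fin.val_last] at h ⊢
      push_cast at h
      have hk : r * (((k : ℕ) : ℝ) + 1) ≠ 0 := mul_ne_zero hr0 (by positivity)
      apply mul_right_cancel₀ hk
      rw [pow_succ]
      linear_combination h - a 0 * K ^ (k : ℕ) * K * r * hch

/-- Frequencies in arithmetic progression together with binomial weights up to a geometric factor
give the probability functions of the binomial family. -/
theorem range_pfun_eq_of_binomial {p : ℕ} {α ω : Fin (p + 1) → ℝ} {r K : ℝ} (hr : r ≠ 0)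
    (hK : 0 < K) (h : ∀ k : Fin (p + 1), α k = α 0 + (k : ℕ) * r ∧
      Real.exp (ω k) = Real.exp (ω 0) * (p.choose k : ℝ) * K ^ (k : ℕ)) :
    Set.range (pfun ω α) =
      Set.range (pfun (fun k => Real.log (Nat.choose p (k : ℕ) : ℝ)) (fun k => ((k : ℕ) : ℝ))) := by
  have hωk : ∀ k : Fin (p + 1),
      ω k = ω 0 + Real.log (p.choose k : ℝ) + (k : ℕ) * Real.log K := by
    intro k
    have hch : (0 : ℝ) < p.choose k := by
      exact_mod_cast Nat.choose_pos (Nat.lt_succ_iff.1 k.2)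
    rw [← Real.log_exp (ω k), (h k).2, Real.log_mul (by positivity) (by positivity),
      Real.log_mul (by positivity) (by positivity), Real.log_exp, Real.log_pow]
  have heq : ∀ θ, pfun ω α θ = pfun (fun k => Real.log (Nat.choose p (k : ℕ) : ℝ))
      (fun k => ((k : ℕ) : ℝ)) (θ * r + Real.log K) := by
    intro θ
    refine pfun_congr (c := ω 0 + θ * α 0) fun k => ?_
    rw [hωk k, (h k).1]
    ring
  apply Set.Subset.antisymm
  · rintro _ ⟨θ, rfl⟩
    exact ⟨_, (heq θ).symm⟩
  · rintro _ ⟨θ, rfl⟩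
    refine ⟨(θ - Real.log K) / r, ?_⟩
    rw [heq, div_mul_cancel₀ _ hr, sub_add_cancel]

theorem stmt13 (m p : ℕ) (C F : Fin (m + 1) → ℝ) (hF : ∃ x y, F x ≠ F y)
    (α : Fin (p + 1) → ℝ) (hα : StrictMono α) (hrange : Set.range α = Set.range F)
    (ω : Fin (p + 1) → ℝ)
    (hω : ∀ k, Real.exp (ω k) = ∑ x, if F x = α k then Real.exp (C x) else 0) :
    ((∃ s : ℝ, ∀ θ : ℝ, hessCurv (psi C F) θ = s) ↔
      Set.range (pfun ω α) =
        Set.range (pfun (fun k => Real.log (Nat.choose p (k : ℕ) : ℝ)) (fun k => ((k : ℕ) : ℝ)))) ∧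
    (∀ s : ℝ, (∀ θ : ℝ, hessCurv (psi C F) θ = s) → s = -(1 / (p : ℝ))) := by
  have hp : p ≠ 0 := by
    rintro rfl
    obtain ⟨x, y, hxy⟩ := hF
    obtain ⟨i, hi⟩ : F x ∈ Set.range α := hrange ▸ Set.mem_range_self x
    obtain ⟨j, hj⟩ : F y ∈ Set.range α := hrange ▸ Set.mem_range_self y
    exact hxy (by rw [← hi, ← hj, Subsingleton.elim (α := Fin 1) i j])
  rw [psi_eq_psi_reduced hα hrange hω]
  refine ⟨⟨?_, fun h => ?_⟩, fun s hs => (binomial_of_hessCurv_eq hp hα hs).1⟩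
  · rintro ⟨s, hs⟩
    obtain ⟨-, r, K, hr, hK, h⟩ := binomial_of_hessCurv_eq hp hα hs
    exact range_pfun_eq_of_binomial hr hK h
  · obtain ⟨A, B, η, q, hq, hψ⟩ := exists_psi_eq_of_range_pfun_eq hp hα h
    rw [hψ]
    exact ⟨_, fun θ => hessCurv_binomial (Nat.cast_pos.2 (Nat.pos_of_ne_zero hp)) A B η q θ hq⟩
end

section
/- Fix an integer n ≥ 1 and let ψ(θ) = n·ln(1 + e^{θ}) for θ ∈ ℝ. Then: (i) ψ is the log-partition function of the binomial family B(n), i.e., ψ(θ) = ln( Σ_{k=0}^{n} (n choose k)·e^{kθ} ); and (ii) ψ''(θ) > 0 and (d²/dθ² ln ψ''(θ))/(2·ψ''(θ)) = −1/n for all θ ∈ ℝ; that is, the binomial family B(n) has constant Hessian sectional curvature −1/n. -/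
theorem hasDerivAt_log_one_add_exp (t : ℝ) :
    HasDerivAt (fun t => Real.log (1 + Real.exp t)) (Real.exp t / (1 + Real.exp t)) t :=
  ((Real.hasDerivAt_exp t).const_add 1).log (by positivity)

theorem hasDerivAt_exp_div_one_add_exp (t : ℝ) :
    HasDerivAt (fun t => Real.exp t / (1 + Real.exp t))
      (Real.exp t / (1 + Real.exp t) ^ 2) t := by
  refine ((Real.hasDerivAt_exp t).fun_div ((Real.hasDerivAt_exp t).const_add 1)
    (by positivity)).congr_deriv ?_
  ring

theorem deriv_deriv_mul_log_one_add_exp (c : ℝ) :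
    deriv (deriv fun t => c * Real.log (1 + Real.exp t)) =
      fun t => c * (Real.exp t / (1 + Real.exp t) ^ 2) := by
  have hderiv : deriv (fun t => c * Real.log (1 + Real.exp t)) =
      fun t => c * (Real.exp t / (1 + Real.exp t)) :=
    funext fun t => ((hasDerivAt_log_one_add_exp t).const_mul c).deriv
  rw [hderiv]
  exact funext fun t => ((hasDerivAt_exp_div_one_add_exp t).const_mul c).deriv

theorem deriv_deriv_log_mul_exp_div_one_add_exp_sq {c : ℝ} (hc : 0 < c) :
    deriv (deriv fun t => Real.log (c * (Real.exp t / (1 + Real.exp t) ^ 2))) =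
      fun t => -(2 * (Real.exp t / (1 + Real.exp t) ^ 2)) := by
  have hlog : (fun t => Real.log (c * (Real.exp t / (1 + Real.exp t) ^ 2))) =
      fun t => Real.log c + (t - 2 * Real.log (1 + Real.exp t)) := by
    funext t
    rw [Real.log_mul hc.ne' (by positivity), Real.log_div (by positivity) (by positivity),
      Real.log_exp, Real.log_pow, Nat.cast_ofNat]
  have hderiv : deriv (fun t => Real.log c + (t - 2 * Real.log (1 + Real.exp t))) =
      fun t => 1 - 2 * (Real.exp t / (1 + Real.exp t)) :=
    funext fun t => (((hasDerivAt_id' t).fun_sub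
      ((hasDerivAt_log_one_add_exp t).const_mul 2)).const_add (Real.log c)).deriv
  rw [hlog, hderiv]
  exact funext fun t => (((hasDerivAt_exp_div_one_add_exp t).const_mul 2).const_sub 1).deriv

theorem stmt14 (n : ℕ) (hn : 1 ≤ n) :
    (∀ θ : ℝ, (n : ℝ) * Real.log (1 + Real.exp θ) =
      Real.log (∑ k ∈ Finset.range (n + 1), (n.choose k : ℝ) * Real.exp (k * θ))) ∧
    (∀ θ : ℝ,
      0 < deriv (deriv (fun t => (n : ℝ) * Real.log (1 + Real.exp t))) θ ∧
      hessCurv (fun t => (n : ℝ) * Real.log (1 + Real.exp t)) θ = -(1 / (n : ℝ))) := by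
  have hc : (0 : ℝ) < n := by exact_mod_cast hn
  refine ⟨fun θ => ?_, fun θ => ⟨?_, ?_⟩⟩
  · rw [← Real.log_pow, add_comm, add_pow]
    congr 1
    refine Finset.sum_congr rfl fun k _ => ?_
    rw [one_pow, mul_one, mul_comm, Real.exp_nat_mul]
  · rw [deriv_deriv_mul_log_one_add_exp]
    positivity
  · simp only [hessCurv, deriv_deriv_mul_log_one_add_exp,
      deriv_deriv_log_mul_exp_div_one_add_exp_sq hc]
    have : 0 < Real.exp θ := Real.exp_pos θ
    field_simp
end

section
/- Fix an integer r ≥ 1 and let ψ(θ) = −r·ln(1 − e^{θ}) for θ ∈ (−∞, 0). Then ψ''(θ) = r·e^{θ}/(1 − e^{θ})² > 0 and (d²/dθ² ln ψ''(θ))/(2·ψ''(θ)) = 1/r for all θ < 0; that is, the negative binomial family NB(r) has constant Hessian sectional curvature 1/r. -/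
lemma one_sub_exp_pos {t : ℝ} (ht : t < 0) : 0 < 1 - Real.exp t :=
  sub_pos.2 (by simpa using ht)

lemma deriv_deriv_eq_of_eqOn_neg {f g h : ℝ → ℝ} {g' θ : ℝ} (hθ : θ < 0)
    (hfh : ∀ t < 0, f t = h t) (hh : ∀ t < 0, HasDerivAt h (g t) t)
    (hg : HasDerivAt g g' θ) : deriv (deriv f) θ = g' := by
  have hev : deriv f =ᶠ[nhds θ] g := by
    filter_upwards [Iio_mem_nhds hθ] with t ht
    have hft : f =ᶠ[nhds t] h := by
      filter_upwards [Iio_mem_nhds ht] with s hs using hfh s hs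
    rw [hft.deriv_eq, (hh t ht).deriv]
  rw [hev.deriv_eq, hg.deriv]

lemma hasDerivAt_log_one_sub_exp {t : ℝ} (ht : t < 0) :
    HasDerivAt (fun t => Real.log (1 - Real.exp t)) (-(Real.exp t / (1 - Real.exp t))) t := by
  have h := ((Real.hasDerivAt_exp t).const_sub 1).log (one_sub_exp_pos ht).ne'
  rwa [neg_div] at h

lemma hasDerivAt_exp_div_one_sub_exp {t : ℝ} (ht : t < 0) :
    HasDerivAt (fun t => Real.exp t / (1 - Real.exp t))
      (Real.exp t / (1 - Real.exp t) ^ 2) t := by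
  have h := (Real.hasDerivAt_exp t).div ((Real.hasDerivAt_exp t).const_sub 1)
    (one_sub_exp_pos ht).ne'
  refine h.congr_deriv ?_
  ring

lemma deriv_deriv_negBinomial_logPartition (r : ℝ) {θ : ℝ} (hθ : θ < 0) :
    deriv (deriv (fun t => -r * Real.log (1 - Real.exp t))) θ =
      r * Real.exp θ / (1 - Real.exp θ) ^ 2 := by
  refine deriv_deriv_eq_of_eqOn_neg (g := fun t => r * (Real.exp t / (1 - Real.exp t))) hθ
    (fun _ _ => rfl) (fun t ht => ?_) ?_
  · exact ((hasDerivAt_log_one_sub_exp ht).const_mul (-r)).congr_deriv (by ring)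
  · exact ((hasDerivAt_exp_div_one_sub_exp hθ).const_mul r).congr_deriv (by ring)

lemma deriv_deriv_log_negBinomial_variance {r : ℝ} (hr : 0 < r) {θ : ℝ} (hθ : θ < 0) :
    deriv (deriv (fun t => Real.log
      (deriv (deriv (fun t => -r * Real.log (1 - Real.exp t))) t))) θ =
      2 * (Real.exp θ / (1 - Real.exp θ) ^ 2) := by
  refine deriv_deriv_eq_of_eqOn_neg
    (h := fun t => (Real.log r + t) - 2 * Real.log (1 - Real.exp t))
    (g := fun t => 1 + 2 * (Real.exp t / (1 - Real.exp t))) hθ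
    (fun t ht => ?_) (fun t ht => ?_) ?_
  · have hpos := one_sub_exp_pos ht
    rw [deriv_deriv_negBinomial_logPartition r ht, Real.log_div (by positivity) (by positivity),
      Real.log_mul hr.ne' (Real.exp_ne_zero t), Real.log_exp, Real.log_pow]
    norm_num
  · exact (((hasDerivAt_id' t).const_add (Real.log r)).sub
      ((hasDerivAt_log_one_sub_exp ht).const_mul 2)).congr_deriv (by ring)
  · exact ((hasDerivAt_exp_div_one_sub_exp hθ).const_mul 2).const_add 1

theorem stmt15 (r : ℕ) (hr : 1 ≤ r) :
    ∀ θ : ℝ, θ < 0 →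
      deriv (deriv (fun t => -(r : ℝ) * Real.log (1 - Real.exp t))) θ =
        (r : ℝ) * Real.exp θ / (1 - Real.exp θ) ^ 2 ∧
      0 < deriv (deriv (fun t => -(r : ℝ) * Real.log (1 - Real.exp t))) θ ∧
      hessCurv (fun t => -(r : ℝ) * Real.log (1 - Real.exp t)) θ = 1 / (r : ℝ) := by
  intro θ hθ
  have hr' : (0 : ℝ) < r := by exact_mod_cast hr
  have hpos := one_sub_exp_pos hθ
  have hψ := deriv_deriv_negBinomial_logPartition (r : ℝ) hθ
  refine ⟨hψ, ?_, ?_⟩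
  · rw [hψ]
    positivity
  · rw [hessCurv, deriv_deriv_log_negBinomial_variance hr' hθ, hψ]
    have hexp := Real.exp_ne_zero θ
    field_simp
end

section
/- A smooth function f : ℝ² → ℝ satisfies the Kähler equations for Γ ≡ 0 (that is, ∂²f/∂x² − ∂²f/∂y² = 0 and ∂²f/∂x∂y = 0 everywhere) if and only if there exist real numbers α, β, γ, δ such that f(x,y) = α + β·x + γ·y + δ·(x² + y²)/2 for all (x,y) ∈ ℝ². Hence the space of such solutions is exactly the 4-dimensional span of 1, x, y, (x² + y²)/2. -/
/-- A function on `ℝ` with constant second derivative is a quadratic polynomial. -/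
theorem eq_quadratic_of_deriv_deriv_eq {g : ℝ → ℝ} {c : ℝ} (hg : Differentiable ℝ g)
    (hg' : Differentiable ℝ (deriv g)) (h : ∀ x, deriv (deriv g) x = c) (x : ℝ) :
    g x = g 0 + deriv g 0 * x + c * x ^ 2 / 2 := by
  have h1 : ∀ x, deriv g x = deriv g 0 + c * x := by
    intro x
    have hd : ∀ t, HasDerivAt (fun t => deriv g t - c * t) 0 t := fun t => by
      have h2 := (hg' t).hasDerivAt.sub ((hasDerivAt_id t).const_mul c)
      rw [h t] at h2
      exact h2.congr_deriv (by simp)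
    have := is_const_of_deriv_eq_zero (fun t => (hd t).differentiableAt)
      (fun t => (hd t).deriv) x 0
    simp only [mul_zero, sub_zero] at this
    linarith
  have hd : ∀ t, HasDerivAt (fun t => g t - (deriv g 0 * t + c / 2 * t ^ 2)) 0 t := fun t => by
    have h2 := (hg t).hasDerivAt.sub (((hasDerivAt_id t).const_mul (deriv g 0)).add
      ((hasDerivAt_pow 2 t).const_mul (c / 2)))
    rw [h1 t] at h2
    exact h2.congr_deriv (by norm_num; ring)
  have := is_const_of_deriv_eq_zero (fun t => (hd t).differentiableAt)
    (fun t => (hd t).deriv) x 0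
  norm_num at this
  linarith

/-- A smooth function of two variables whose mixed derivative vanishes is a sum of functions of
one variable. -/
theorem eq_add_of_pdx_pdy_eq_zero {f : ℝ → ℝ → ℝ}
    (hf : ContDiff ℝ (⊤ : ℕ∞) (fun p : ℝ × ℝ => f p.1 p.2))
    (h : ∀ x y, pdx (pdy f) x y = 0) (x y : ℝ) : f x y = f x 0 + (f 0 y - f 0 0) := by
  have hy : ∀ x, Differentiable ℝ (fun t => f x t) := fun x =>
    (hf.comp (contDiff_prodMk_right x)).differentiable (by simp)
  have hpdy : ∀ x y, pdy f x y = fderiv ℝ (fun p : ℝ × ℝ => f p.1 p.2) (x, y) (0, 1) := by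
    intro x y
    have h1 : HasDerivAt (fun t : ℝ => (x, t)) ((0 : ℝ), (1 : ℝ)) y :=
      (hasDerivAt_const y x).prodMk (hasDerivAt_id y)
    exact ((hf.differentiable (by simp) (x, y)).hasFDerivAt.comp_hasDerivAt y h1).deriv
  have hdiff : ∀ y, Differentiable ℝ (fun t => pdy f t y) := by
    intro y
    simp only [hpdy]
    have h1 : ContDiff ℝ 1 (fderiv ℝ (fun p : ℝ × ℝ => f p.1 p.2)) :=
      hf.fderiv_right (m := 1) (WithTop.coe_le_coe.mpr le_top)
    exact ((h1.comp (contDiff_prodMk_left y)).clm_apply contDiff_const).differentiable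
      (by simp)
  have hc : ∀ x y, pdy f x y = pdy f 0 y := fun x y =>
    is_const_of_deriv_eq_zero (hdiff y) (fun t => h t y) x 0
  have hd : ∀ t, HasDerivAt (fun t => f x t - f 0 t) 0 t := fun t => by
    have h2 := (hy x t).hasDerivAt.sub (hy 0 t).hasDerivAt
    have h3 : deriv (fun t => f x t) t = deriv (fun t => f 0 t) t := hc x t
    rw [h3, sub_self] at h2
    exact h2
  have := is_const_of_deriv_eq_zero (fun t => (hd t).differentiableAt)
    (fun t => (hd t).deriv) y 0
  linarith

/-- The derivative of a quadratic polynomial. -/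
theorem hasDerivAt_quadratic (a b c x : ℝ) :
    HasDerivAt (fun t => a + b * t + c * t ^ 2 / 2) (b + c * x) x := by
  have h := (((hasDerivAt_id x).const_mul b).const_add a).add
    (((hasDerivAt_pow 2 x).const_mul c).div_const 2)
  exact h.congr_deriv (by norm_num; ring)

theorem hasDerivAt_affine (a b x : ℝ) : HasDerivAt (fun t => a + b * t) b x := by
  simpa using ((hasDerivAt_id x).const_mul b).const_add a

theorem stmt17 (f : ℝ → ℝ → ℝ) (hf : ContDiff ℝ (⊤ : ℕ∞) (fun p : ℝ × ℝ => f p.1 p.2)) :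
    KahlerEqs Set.univ (fun _ => 0) f ↔
      ∃ α β γ δ : ℝ, ∀ x y : ℝ,
        f x y = α + β * x + γ * y + δ * (x ^ 2 + y ^ 2) / 2 := by
  constructor
  · intro h
    have hsep := eq_add_of_pdx_pdy_eq_zero hf fun x y => by
      simpa using (h x (Set.mem_univ x) y).2
    have hu : ContDiff ℝ (⊤ : ℕ∞) (fun t => f t 0) := hf.comp (contDiff_prodMk_left 0)
    have hv : ContDiff ℝ (⊤ : ℕ∞) (fun t => f 0 t) := hf.comp (contDiff_prodMk_right 0)
    have hx : pdx f = fun x _ => deriv (fun t => f t 0) x := by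
      funext x y
      have : (fun t => f t y) = fun t => f t 0 + (f 0 y - f 0 0) := funext fun t => hsep t y
      rw [pdx, this, deriv_add_const]
    have hy : pdy f = fun _ y => deriv (fun t => f 0 t) y := by
      funext x y
      have : (fun t => f x t) = fun t => f 0 t + (f x 0 - f 0 0) :=
        funext fun t => by rw [hsep x t]; ring
      rw [pdy, this, deriv_add_const]
    have heq : ∀ x y, deriv (deriv fun t => f t 0) x = deriv (deriv fun t => f 0 t) y := by
      intro x y
      have := (h x (Set.mem_univ x) y).1
      rw [hx, hy] at this
      simp only [mul_zero, zero_mul] at this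
      exact sub_eq_zero.mp this
    have hu' : Differentiable ℝ (deriv fun t => f t 0) :=
      (contDiff_infty_iff_deriv.mp hu).2.differentiable (by simp)
    have hv' : Differentiable ℝ (deriv fun t => f 0 t) :=
      (contDiff_infty_iff_deriv.mp hv).2.differentiable (by simp)
    refine ⟨f 0 0, deriv (fun t => f t 0) 0, deriv (fun t => f 0 t) 0,
      deriv (deriv fun t => f 0 t) 0, fun x y => ?_⟩
    have h1 := eq_quadratic_of_deriv_deriv_eq (hu.differentiable (by simp)) hu'
      (fun t => heq t 0) x
    have h2 := eq_quadratic_of_deriv_deriv_eq (hv.differentiable (by simp)) hv'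
      (fun t => (heq 0 t).symm.trans (heq 0 0)) y
    rw [hsep x y]
    linarith
  · rintro ⟨α, β, γ, δ, h⟩
    have hx : pdx f = fun x _ => β + δ * x := by
      funext x y
      have : (fun t => f t y) = fun t => (α + γ * y + δ * y ^ 2 / 2) + β * t + δ * t ^ 2 / 2 :=
        funext fun t => by rw [h]; ring
      rw [pdx, this, (hasDerivAt_quadratic _ _ _ _).deriv]
    have hy : pdy f = fun _ y => γ + δ * y := by
      funext x y
      have : (fun t => f x t) = fun t => (α + β * x + δ * x ^ 2 / 2) + γ * t + δ * t ^ 2 / 2 :=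
        funext fun t => by rw [h]; ring
      rw [pdy, this, (hasDerivAt_quadratic _ _ _ _).deriv]
    intro x _ y
    rw [hx, hy]
    simp only [pdx, pdy, (hasDerivAt_affine _ _ _).deriv, deriv_const]
    simp
end

section
/- Let a ≠ 0 be a real number. A smooth function f : ℝ² → ℝ satisfies the Kähler equations for the constant function Γ ≡ a/2 (that is, ∂²f/∂x² − ∂²f/∂y² = a·∂f/∂x and ∂²f/∂x∂y = (a/2)·∂f/∂y everywhere) if and only if there exist real numbers α₁, α₂, α₃, α₄ such that f(x,y) = α₁ + α₂·e^{a x} + α₃·cos(a y/2)·e^{a x/2} + α₄·sin(a y/2)·e^{a x/2} for all (x,y) ∈ ℝ². Hence the space of such solutions is exactly the 4-dimensional span of 1, e^{ax}, cos(ay/2)e^{ax/2}, sin(ay/2)e^{ax/2}. -/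
theorem eq_of_hasDerivAt_zero {g : ℝ → ℝ} (hg : ∀ x, HasDerivAt g 0 x) (x y : ℝ) : g x = g y :=
  is_const_of_deriv_eq_zero (fun t => (hg t).differentiableAt) (fun t => (hg t).deriv) x y

theorem hasDerivAt_exp_const_mul (k x : ℝ) :
    HasDerivAt (fun t => Real.exp (k * t)) (k * Real.exp (k * x)) x := by
  simpa [mul_comm] using ((hasDerivAt_id x).const_mul k).exp

theorem hasDerivAt_cos_const_mul (k x : ℝ) :
    HasDerivAt (fun t => Real.cos (k * t)) (-k * Real.sin (k * x)) x := by
  simpa [mul_comm] using ((hasDerivAt_id x).const_mul k).cos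

theorem hasDerivAt_sin_const_mul (k x : ℝ) :
    HasDerivAt (fun t => Real.sin (k * t)) (k * Real.cos (k * x)) x := by
  simpa [mul_comm] using ((hasDerivAt_id x).const_mul k).sin

/-- Solutions of `u' = k u` are exponentials. -/
theorem eq_exp_of_hasDerivAt {u : ℝ → ℝ} {k : ℝ} (hu : ∀ x, HasDerivAt u (k * u x) x) (x : ℝ) :
    u x = Real.exp (k * x) * u 0 := by
  have h := eq_of_hasDerivAt_zero (g := fun t => u t * Real.exp (-k * t)) (fun t => by
    refine HasDerivAt.congr_deriv ((hu t).mul (hasDerivAt_exp_const_mul (-k) t)) ?_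
    ring) x 0
  have hE : Real.exp (k * x) * Real.exp (-k * x) = 1 := by
    rw [← Real.exp_add]
    simp
  simp only [mul_zero, Real.exp_zero, mul_one] at h
  linear_combination Real.exp (k * x) * h - u x * hE

/-- Solutions of `G'' + w² G = c`. -/
theorem eq_cos_add_sin_of_hasDerivAt {G G' : ℝ → ℝ} {w c : ℝ} (hw : w ≠ 0)
    (hG : ∀ y, HasDerivAt G (G' y) y) (hG' : ∀ y, HasDerivAt G' (c - w ^ 2 * G y) y) :
    ∃ A B : ℝ, ∀ y, G y = c / w ^ 2 + A * Real.cos (w * y) + B * Real.sin (w * y) := by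
  have hP (y : ℝ) := eq_of_hasDerivAt_zero
    (g := fun t => (G t - c / w ^ 2) * Real.cos (w * t) - G' t / w * Real.sin (w * t))
    (fun t => by
      refine HasDerivAt.congr_deriv
        ((((hG t).sub_const (c / w ^ 2)).mul (hasDerivAt_cos_const_mul w t)).sub
        (((hG' t).div_const w).mul (hasDerivAt_sin_const_mul w t))) ?_
      field_simp
      ring) y 0
  have hQ (y : ℝ) := eq_of_hasDerivAt_zero
    (g := fun t => (G t - c / w ^ 2) * Real.sin (w * t) + G' t / w * Real.cos (w * t))
    (fun t => by
      refine HasDerivAt.congr_deriv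
        ((((hG t).sub_const (c / w ^ 2)).mul (hasDerivAt_sin_const_mul w t)).add
        (((hG' t).div_const w).mul (hasDerivAt_cos_const_mul w t))) ?_
      field_simp
      ring) y 0
  refine ⟨G 0 - c / w ^ 2, G' 0 / w, fun y => ?_⟩
  have h1 := hP y
  have h2 := hQ y
  simp only [mul_zero, Real.cos_zero, Real.sin_zero, mul_one, sub_zero, zero_add] at h1 h2
  linear_combination Real.cos (w * y) * h1 + Real.sin (w * y) * h2
    - (G y - c / w ^ 2) * Real.sin_sq_add_cos_sq (w * y)

/-- Solutions of `H'' - 2 w H' = c e^{w x}`. -/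
theorem eq_exp_add_exp_of_hasDerivAt {H H' H'' : ℝ → ℝ} {w c : ℝ} (hw : w ≠ 0)
    (hH : ∀ x, HasDerivAt H (H' x) x) (hH' : ∀ x, HasDerivAt H' (H'' x) x)
    (heq : ∀ x, H'' x - 2 * w * H' x = c * Real.exp (w * x)) :
    ∃ A B : ℝ, ∀ x, H x = A + B * Real.exp (2 * w * x) - c / w ^ 2 * Real.exp (w * x) := by
  have hfirst (x : ℝ) := eq_of_hasDerivAt_zero
    (g := fun t => H' t - 2 * w * H t - c / w * Real.exp (w * t))
    (fun t => by
      refine HasDerivAt.congr_deriv (((hH' t).sub ((hH t).const_mul (2 * w))).sub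
        ((hasDerivAt_exp_const_mul w t).const_mul (c / w))) ?_
      rw [heq]
      field_simp
      ring) x 0
  set k := H' 0 - 2 * w * H 0 - c / w * Real.exp (w * 0)
  have hlin := eq_exp_of_hasDerivAt (k := 2 * w)
    (u := fun t => H t + c / w ^ 2 * Real.exp (w * t) + k / (2 * w)) (fun t => by
      refine HasDerivAt.congr_deriv
        (((hH t).add ((hasDerivAt_exp_const_mul w t).const_mul (c / w ^ 2))).add_const
        (k / (2 * w))) ?_
      rw [← hfirst t]
      field_simp
      ring)
  refine ⟨-(k / (2 * w)), H 0 + c / w ^ 2 * Real.exp (w * 0) + k / (2 * w), fun x => ?_⟩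
  linear_combination hlin x

theorem hasDerivAt_pdx {f : ℝ → ℝ → ℝ} (hf : Differentiable ℝ (fun p : ℝ × ℝ => f p.1 p.2))
    (x y : ℝ) : HasDerivAt (fun t => f t y) (pdx f x y) x := by
  have h : Differentiable ℝ (fun t => f t y) :=
    hf.comp (differentiable_id.prodMk (differentiable_const y))
  exact (h x).hasDerivAt

theorem hasDerivAt_pdy {f : ℝ → ℝ → ℝ} (hf : Differentiable ℝ (fun p : ℝ × ℝ => f p.1 p.2))
    (x y : ℝ) : HasDerivAt (fun t => f x t) (pdy f x y) y := by
  have h : Differentiable ℝ (fun t => f x t) :=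
    hf.comp ((differentiable_const x).prodMk differentiable_id)
  exact (h y).hasDerivAt

theorem contDiff_pdx {f : ℝ → ℝ → ℝ}
    (hf : ContDiff ℝ (⊤ : ℕ∞) (fun p : ℝ × ℝ => f p.1 p.2)) :
    ContDiff ℝ (⊤ : ℕ∞) (fun p : ℝ × ℝ => pdx f p.1 p.2) := by
  have h : (fun p : ℝ × ℝ => pdx f p.1 p.2) =
      fun p => fderiv ℝ (fun p : ℝ × ℝ => f p.1 p.2) p (1, 0) := by
    funext p
    have hd := (hf.differentiable (by simp) p).hasFDerivAt
    exact (hd.comp_hasDerivAt p.1 ((hasDerivAt_id p.1).prodMk (hasDerivAt_const p.1 p.2))).deriv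
  rw [h]
  exact (hf.fderiv_right (by simp)).clm_apply contDiff_const

theorem contDiff_pdy {f : ℝ → ℝ → ℝ}
    (hf : ContDiff ℝ (⊤ : ℕ∞) (fun p : ℝ × ℝ => f p.1 p.2)) :
    ContDiff ℝ (⊤ : ℕ∞) (fun p : ℝ × ℝ => pdy f p.1 p.2) := by
  have h : (fun p : ℝ × ℝ => pdy f p.1 p.2) =
      fun p => fderiv ℝ (fun p : ℝ × ℝ => f p.1 p.2) p (0, 1) := by
    funext p
    have hd := (hf.differentiable (by simp) p).hasFDerivAt
    exact (hd.comp_hasDerivAt p.2 ((hasDerivAt_const p.2 p.1).prodMk (hasDerivAt_id p.2))).deriv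
  rw [h]
  exact (hf.fderiv_right (by simp)).clm_apply contDiff_const

/-- A function with `f_xy = w f_y` splits as `e^{w x} G(y) + H(x)`. -/
theorem eq_exp_mul_add_of_pdx_pdy {f : ℝ → ℝ → ℝ} {w : ℝ}
    (hf : ContDiff ℝ (⊤ : ℕ∞) (fun p : ℝ × ℝ => f p.1 p.2))
    (h : ∀ x y, pdx (pdy f) x y = w * pdy f x y) (x y : ℝ) :
    f x y = Real.exp (w * x) * (f 0 y - f 0 0) + f x 0 := by
  have hd := hf.differentiable (by simp)
  have hy (x y : ℝ) : pdy f x y = Real.exp (w * x) * pdy f 0 y :=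
    eq_exp_of_hasDerivAt (u := fun t => pdy f t y) (fun t => by
      rw [← h]
      exact hasDerivAt_pdx ((contDiff_pdy hf).differentiable (by simp)) t y) x
  have hc := eq_of_hasDerivAt_zero (g := fun t => f x t - Real.exp (w * x) * f 0 t) (fun t => by
    refine HasDerivAt.congr_deriv
      ((hasDerivAt_pdy hd x t).sub
        ((hasDerivAt_pdy hd 0 t).const_mul (Real.exp (w * x)))) ?_
    rw [hy x t, sub_self]) y 0
  linear_combination hc

/-- Partial derivatives of a function in split form `e^{w x} G(y) + H(x)`. -/
theorem partials_of_eq_exp_mul_add {f : ℝ → ℝ → ℝ} {G G' G'' H H' H'' : ℝ → ℝ} {w : ℝ}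
    (hG : ∀ y, HasDerivAt G (G' y) y) (hG' : ∀ y, HasDerivAt G' (G'' y) y)
    (hH : ∀ x, HasDerivAt H (H' x) x) (hH' : ∀ x, HasDerivAt H' (H'' x) x)
    (hf : ∀ x y, f x y = Real.exp (w * x) * G y + H x) (x y : ℝ) :
    pdx f x y = w * Real.exp (w * x) * G y + H' x ∧
    pdx (pdx f) x y = w ^ 2 * Real.exp (w * x) * G y + H'' x ∧
    pdy f x y = Real.exp (w * x) * G' y ∧
    pdy (pdy f) x y = Real.exp (w * x) * G'' y ∧
    pdx (pdy f) x y = w * Real.exp (w * x) * G' y := by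
  obtain rfl : f = fun x y => Real.exp (w * x) * G y + H x := by
    funext x y
    exact hf x y
  have hx : pdx (fun x y => Real.exp (w * x) * G y + H x) =
      fun x y => w * Real.exp (w * x) * G y + H' x := by
    funext x y
    exact (((hasDerivAt_exp_const_mul w x).mul_const (G y)).add (hH x)).deriv
  have hy : pdy (fun x y => Real.exp (w * x) * G y + H x) =
      fun x y => Real.exp (w * x) * G' y := by
    funext x y
    exact (((hG y).const_mul (Real.exp (w * x))).add_const (H x)).deriv
  rw [hx, hy]
  refine ⟨rfl, ?_, rfl, ((hG' y).const_mul (Real.exp (w * x))).deriv,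
    ((hasDerivAt_exp_const_mul w x).mul_const (G' y)).deriv⟩
  refine ((((hasDerivAt_exp_const_mul w x).const_mul w).mul_const (G y)).add (hH' x)).deriv.trans ?_
  ring

theorem stmt18 (a : ℝ) (ha : a ≠ 0) (f : ℝ → ℝ → ℝ)
    (hf : ContDiff ℝ (⊤ : ℕ∞) (fun p : ℝ × ℝ => f p.1 p.2)) :
    KahlerEqs Set.univ (fun _ => a / 2) f ↔
      ∃ α₁ α₂ α₃ α₄ : ℝ, ∀ x y : ℝ,
        f x y = α₁ + α₂ * Real.exp (a * x)
          + α₃ * Real.cos (a * y / 2) * Real.exp (a * x / 2)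
          + α₄ * Real.sin (a * y / 2) * Real.exp (a * x / 2) := by
  have hw : a / 2 ≠ 0 := div_ne_zero ha two_ne_zero
  have ey (y : ℝ) : a * y / 2 = a / 2 * y := by ring
  have e2 (x : ℝ) : 2 * (a / 2) * x = a * x := by ring
  simp only [KahlerEqs, Set.mem_univ, true_implies, ey]
  constructor
  · intro h
    have hd := hf.differentiable (by simp)
    have hsplit := eq_exp_mul_add_of_pdx_pdy hf fun x y => (h x y).2
    have hG (y : ℝ) : HasDerivAt (fun t => f 0 t - f 0 0) (pdy f 0 y) y :=
      (hasDerivAt_pdy hd 0 y).sub_const _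
    have hG' (y : ℝ) : HasDerivAt (fun t => pdy f 0 t) (pdy (pdy f) 0 y) y :=
      hasDerivAt_pdy ((contDiff_pdy hf).differentiable (by simp)) 0 y
    have hH (x : ℝ) : HasDerivAt (fun t => f t 0) (pdx f x 0) x := hasDerivAt_pdx hd x 0
    have hH' (x : ℝ) : HasDerivAt (fun t => pdx f t 0) (pdx (pdx f) x 0) x :=
      hasDerivAt_pdx ((contDiff_pdx hf).differentiable (by simp)) x 0
    have hp := partials_of_eq_exp_mul_add hG hG' hH hH' hsplit
    have key (x y : ℝ) : pdx (pdx f) x 0 - 2 * (a / 2) * pdx f x 0 =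
        Real.exp (a / 2 * x) * (pdy (pdy f) 0 y + (a / 2) ^ 2 * (f 0 y - f 0 0)) := by
      obtain ⟨h1, h2, -, h4, -⟩ := hp x y
      have h0 := (h x y).1
      rw [h1, h2, h4] at h0
      linear_combination h0
    obtain ⟨A, B, hAB⟩ := eq_cos_add_sin_of_hasDerivAt (c := pdy (pdy f) 0 0) hw hG fun y => by
      have h1 := (key 0 y).symm.trans (key 0 0)
      simp only [mul_zero, Real.exp_zero, one_mul, sub_self, add_zero] at h1
      rw [← h1, add_sub_cancel_right]
      exact hG' y
    obtain ⟨C, D, hCD⟩ := eq_exp_add_exp_of_hasDerivAt (c := pdy (pdy f) 0 0) hw hH hH'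
      fun x => by
        rw [key x 0]
        ring
    refine ⟨C, D, A, B, fun x y => ?_⟩
    rw [hsplit x y, hAB y, hCD x, e2]
    ring
  · rintro ⟨α₁, α₂, α₃, α₄, h⟩ x y
    obtain ⟨h1, h2, h3, h4, h5⟩ := partials_of_eq_exp_mul_add (w := a / 2) (f := f)
      (fun y => ((hasDerivAt_cos_const_mul (a / 2) y).const_mul α₃).add
        ((hasDerivAt_sin_const_mul (a / 2) y).const_mul α₄))
      (fun y => (((hasDerivAt_sin_const_mul (a / 2) y).const_mul (-(a / 2))).const_mul α₃).add
        (((hasDerivAt_cos_const_mul (a / 2) y).const_mul (a / 2)).const_mul α₄))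
      (fun x => ((hasDerivAt_exp_const_mul a x).const_mul α₂).const_add α₁)
      (fun x => ((hasDerivAt_exp_const_mul a x).const_mul a).const_mul α₂)
      (fun x y => by
        rw [h x y]
        simp only [Pi.add_apply]
        ring) x y
    rw [h1, h2, h3, h4, h5]
    simp only [Pi.add_apply]
    constructor <;> ring
end
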